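/- arXiv:1409.8566 — 4 statements merged into one kernel-verified Lean document; each statement's English description precedes it below -/
import Mathlib

section
/- Let a = (a_1,…,a_n) be a vector of nonnegative integers with a_1 > 0. The Tesler polytope Tes_n(a) is a simple polytope if and only if n ≤ 3 or one of the following four conditions holds: (i) a_i > 0 for all 1 ≤ i ≤ n; (ii) a_i > 0 for all 1 ≤ i ≤ n−1 and a_n = 0; (iii) a_2 = 0 and a_i > 0 for all i ≠ 2; (iv) a_2 = 0, a_n = 0, and a_i > 0 for all i ∉ {2,n}. -/
open Finset

/-- The Tesler polytope `Tes_n(a)`: upper triangular `n × n` matrices with nonnegative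
real entries whose `k`-th hook sum equals `a k`.  Entries strictly below the diagonal
are required to be `0`. -/
def TeslerPolytope (n : ℕ) (a : Fin n → ℕ) : Set (Fin n → Fin n → ℝ) :=
  {x | (∀ i j : Fin n, j < i → x i j = 0) ∧
       (∀ i j : Fin n, i ≤ j → 0 ≤ x i j) ∧
       (∀ k : Fin n,
         (∑ j ∈ univ.filter (fun j => k ≤ j), x k j)
           - (∑ i ∈ univ.filter (fun i => i < k), x i k) = (a k : ℝ))}

/-- A polytope `P` is simple if each of its vertices (extreme points) is contained
in exactly `dim P` edges of `P`, where faces are nonempty exposed subsets, edges are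
faces of affine dimension `1`, and `dim` is the dimension of the affine span. -/
def IsSimplePolytope {E : Type*} [NormedAddCommGroup E] [NormedSpace ℝ E]
    (P : Set E) : Prop :=
  ∀ v ∈ Set.extremePoints ℝ P,
    ({F : Set E | F.Nonempty ∧ IsExposed ℝ P F ∧
        Module.finrank ℝ (affineSpan ℝ F).direction = 1 ∧ v ∈ F}).ncard =
      Module.finrank ℝ (affineSpan ℝ P).direction

/-- If `P` is generated near `v` by finitely many exposed rays `g i`, then the edges of `P` at `v`
are counted by those rays. -/
theorem ncard_edges_eq_finrank_iff {E ι : Type*} [NormedAddCommGroup E] [NormedSpace ℝ E]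
    [Fintype ι] {P : Set E} {v : E} (hv : v ∈ P) (g : ι → E)
    (hfeas : ∀ i, ∃ ε : ℝ, 0 < ε ∧ v + ε • g i ∈ P)
    (hgen : ∀ x ∈ P, ∃ c : ι → ℝ, (∀ i, 0 ≤ c i) ∧ x = v + ∑ i, c i • g i)
    (hexp : ∀ i, ∃ l : StrongDual ℝ E, l (g i) = 0 ∧ ∀ j, j ≠ i → l (g j) < 0)
    (hne : ∀ i, g i ≠ 0) :
    ({F : Set E | F.Nonempty ∧ IsExposed ℝ P F ∧
        Module.finrank ℝ (affineSpan ℝ F).direction = 1 ∧ v ∈ F}).ncard =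
      Module.finrank ℝ (affineSpan ℝ P).direction ↔ LinearIndependent ℝ g := by
  classical
  set R : ι → Set E := fun i => {x | x ∈ P ∧ ∃ c : ℝ, 0 ≤ c ∧ x = v + c • g i} with hR
  have hvR : ∀ i, v ∈ R i := fun i => ⟨hv, 0, le_rfl, by simp⟩
  have hεR : ∀ i, ∃ ε : ℝ, 0 < ε ∧ v + ε • g i ∈ R i := fun i => by
    obtain ⟨ε, hε, h⟩ := hfeas i
    exact ⟨ε, hε, h, ε, hε.le, rfl⟩
  have hdirmem : ∀ (F : Set E), v ∈ F → ∀ i, ∀ ε : ℝ, 0 < ε → v + ε • g i ∈ F →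
      g i ∈ (affineSpan ℝ F).direction := by
    intro F hF i ε hε h
    rw [direction_affineSpan]
    have h1 := vsub_mem_vectorSpan ℝ h hF
    have h2 : g i = ε⁻¹ • ((v + ε • g i) -ᵥ v) := by
      rw [vsub_eq_sub, add_sub_cancel_left, smul_smul, inv_mul_cancel₀ hε.ne', one_smul]
    rw [h2]
    exact Submodule.smul_mem _ _ h1
  have hdirle : ∀ (F : Set E), v ∈ F → ∀ W : Submodule ℝ E, (∀ x ∈ F, x - v ∈ W) →
      (affineSpan ℝ F).direction ≤ W := by
    intro F hF W h
    rw [direction_affineSpan, vectorSpan_eq_span_vsub_set_right ℝ hF, Submodule.span_le]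
    rintro _ ⟨x, hx, rfl⟩
    exact h x hx
  have hdirR : ∀ i, (affineSpan ℝ (R i)).direction = Submodule.span ℝ {g i} := by
    intro i
    apply le_antisymm
    · refine hdirle _ (hvR i) _ ?_
      rintro x ⟨-, c, -, rfl⟩
      rw [add_sub_cancel_left]
      exact Submodule.smul_mem _ _ (Submodule.mem_span_singleton_self _)
    · rw [Submodule.span_singleton_le_iff_mem]
      obtain ⟨ε, hε, h⟩ := hεR i
      exact hdirmem _ (hvR i) i ε hε h
  have hpar : ∀ i j, i ≠ j → g j ∉ Submodule.span ℝ {g i} := by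
    intro i j hij h
    obtain ⟨c, hc⟩ := Submodule.mem_span_singleton.1 h
    obtain ⟨l, hl, hlj⟩ := hexp i
    have := hlj j hij.symm
    rw [← hc, map_smul, hl, smul_zero] at this
    exact lt_irrefl _ this
  have hinj : Function.Injective R := by
    intro i j hij
    by_contra hne'
    apply hpar i j hne'
    rw [← hdirR i, hij, hdirR j]
    exact Submodule.mem_span_singleton_self _
  have hface : ∀ (l : StrongDual ℝ E) (i : ι), (∀ j, l (g j) ≤ 0) → l (g i) = 0 →
      (∀ j, j ≠ i → l (g j) < 0) → {x ∈ P | ∀ y ∈ P, l y ≤ l x} = R i := by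
    intro l i hle h0 hlt
    have hmax : ∀ y ∈ P, l y ≤ l v := by
      intro y hy
      obtain ⟨c, hc, rfl⟩ := hgen y hy
      simp only [map_add, map_sum, map_smul, smul_eq_mul]
      have : ∑ j, c j * l (g j) ≤ 0 :=
        Finset.sum_nonpos fun j _ => mul_nonpos_of_nonneg_of_nonpos (hc j) (hle j)
      linarith
    ext x
    constructor
    · rintro ⟨hx, hxl⟩
      refine ⟨hx, ?_⟩
      obtain ⟨c, hc, rfl⟩ := hgen x hx
      have h1 := hxl v hv
      simp only [map_add, map_sum, map_smul, smul_eq_mul] at h1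
      have h2 : ∀ j ∈ univ, c j * l (g j) ≤ 0 :=
        fun j _ => mul_nonpos_of_nonneg_of_nonpos (hc j) (hle j)
      have h3 : ∑ j, c j * l (g j) = 0 := le_antisymm (Finset.sum_nonpos h2) (by linarith)
      rw [Finset.sum_eq_zero_iff_of_nonpos h2] at h3
      refine ⟨c i, hc i, ?_⟩
      rw [Finset.sum_eq_single i]
      · intro j _ hj
        rcases mul_eq_zero.1 (h3 j (mem_univ _)) with h | h
        · rw [h, zero_smul]
        · exact absurd h (hlt j hj).ne
      · simp
    · rintro ⟨hx, c, hc, rfl⟩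
      refine ⟨hx, fun y hy => ?_⟩
      rw [map_add, map_smul, h0, smul_zero, add_zero]
      exact hmax y hy
  have hset : {F : Set E | F.Nonempty ∧ IsExposed ℝ P F ∧
        Module.finrank ℝ (affineSpan ℝ F).direction = 1 ∧ v ∈ F} = Set.range R := by
    ext F
    constructor
    · rintro ⟨hFne, hF, hdim, hvF⟩
      obtain ⟨l, rfl⟩ := hF hFne
      have hle : ∀ j, l (g j) ≤ 0 := by
        intro j
        obtain ⟨ε, hε, h⟩ := hfeas j
        have := hvF.2 _ h
        rw [map_add, map_smul, smul_eq_mul] at this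
        by_contra! hpos
        have := mul_pos hε hpos
        linarith
      have hmem : ∀ j, l (g j) = 0 →
          g j ∈ (affineSpan ℝ {x ∈ P | ∀ y ∈ P, l y ≤ l x}).direction := by
        intro j hj
        obtain ⟨ε, hε, h⟩ := hfeas j
        refine hdirmem _ hvF j ε hε ⟨h, fun y hy => ?_⟩
        rw [map_add, map_smul, hj, smul_zero, add_zero]
        exact hvF.2 y hy
      have hex : ∃ i, l (g i) = 0 := by
        by_contra! hno
        have hbot : (affineSpan ℝ {x ∈ P | ∀ y ∈ P, l y ≤ l x}).direction ≤ ⊥ := by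
          refine hdirle _ hvF _ ?_
          rintro x ⟨hx, hxl⟩
          obtain ⟨c, hc, rfl⟩ := hgen x hx
          have h1 := hxl v hv
          simp only [map_add, map_sum, map_smul, smul_eq_mul] at h1
          have h2 : ∀ j ∈ univ, c j * l (g j) ≤ 0 :=
            fun j _ => mul_nonpos_of_nonneg_of_nonpos (hc j) (hle j)
          have h3 : ∑ j, c j * l (g j) = 0 := le_antisymm (Finset.sum_nonpos h2) (by linarith)
          rw [Finset.sum_eq_zero_iff_of_nonpos h2] at h3
          rw [Submodule.mem_bot, add_sub_cancel_left]
          refine Finset.sum_eq_zero fun j _ => ?_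
          rcases mul_eq_zero.1 (h3 j (mem_univ _)) with h | h
          · rw [h, zero_smul]
          · exact absurd h (hno j)
        rw [le_bot_iff.1 hbot, finrank_bot] at hdim
        exact zero_ne_one hdim
      obtain ⟨i, hi⟩ := hex
      refine ⟨i, (hface l i hle hi fun j hj => lt_of_le_of_ne (hle j) fun h0 => ?_).symm⟩
      apply hpar i j hj.symm
      obtain ⟨c, hc⟩ := (finrank_eq_one_iff_of_nonzero' (⟨g i, hmem i hi⟩ :
        (affineSpan ℝ {x ∈ P | ∀ y ∈ P, l y ≤ l x}).direction)
        (fun h => hne i (congrArg Subtype.val h))).1 hdim ⟨g j, hmem j h0⟩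
      exact Submodule.mem_span_singleton.2 ⟨c, congrArg Subtype.val hc⟩
    · rintro ⟨i, rfl⟩
      refine ⟨⟨v, hvR i⟩, fun _ => ?_, ?_, hvR i⟩
      · obtain ⟨l, hl, hlt⟩ := hexp i
        refine ⟨l, (hface l i (fun j => ?_) hl hlt).symm⟩
        by_cases h : j = i
        · rw [h, hl]
        · exact (hlt j h).le
      · rw [hdirR, finrank_span_singleton (hne i)]
  have hdirP : (affineSpan ℝ P).direction = Submodule.span ℝ (Set.range g) := by
    apply le_antisymm
    · refine hdirle _ hv _ fun x hx => ?_
      obtain ⟨c, -, rfl⟩ := hgen x hx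
      rw [add_sub_cancel_left]
      exact Submodule.sum_mem _ fun i _ =>
        Submodule.smul_mem _ _ (Submodule.subset_span ⟨i, rfl⟩)
    · rw [Submodule.span_le]
      rintro _ ⟨i, rfl⟩
      obtain ⟨ε, hε, h⟩ := hfeas i
      exact hdirmem _ hv i ε hε h
  rw [hset, hdirP, linearIndependent_iff_card_eq_finrank_span, ← Nat.card_eq_fintype_card,
    ← Set.image_univ, Set.ncard_image_of_injective _ hinj, Set.ncard_univ]
  rfl

/-- The hook sums of a square matrix, as a linear map. -/
def hookSum (n : ℕ) : (Fin n → Fin n → ℝ) →ₗ[ℝ] (Fin n → ℝ) where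
  toFun x k := (∑ j ∈ univ.filter (fun j => k ≤ j), x k j)
           - (∑ i ∈ univ.filter (fun i => i < k), x i k)
  map_add' x y := by
    funext k
    simp only [Pi.add_apply, Finset.sum_add_distrib]
    ring
  map_smul' c x := by
    funext k
    simp only [Pi.smul_apply, smul_eq_mul, ← Finset.mul_sum, RingHom.id_apply]
    ring

theorem hookSum_apply {n : ℕ} (x : Fin n → Fin n → ℝ) (k : Fin n) :
    hookSum n x k = (∑ j ∈ univ.filter (fun j => k ≤ j), x k j)
           - (∑ i ∈ univ.filter (fun i => i < k), x i k) := rfl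

/-- Upper triangular matrices all of whose hook sums vanish. -/
def circulations (n : ℕ) : Submodule ℝ (Fin n → Fin n → ℝ) where
  carrier := {d | (∀ i j, j < i → d i j = 0) ∧ hookSum n d = 0}
  add_mem' := by
    rintro x y ⟨hx, hx'⟩ ⟨hy, hy'⟩
    exact ⟨fun i j h => by simp [hx i j h, hy i j h], by rw [map_add, hx', hy', add_zero]⟩
  zero_mem' := ⟨fun _ _ _ => rfl, map_zero _⟩
  smul_mem' := by
    rintro c x ⟨hx, hx'⟩
    exact ⟨fun i j h => by simp [hx i j h], by rw [map_smul, hx', smul_zero]⟩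

theorem mem_teslerPolytope {n : ℕ} {a : Fin n → ℕ} {x : Fin n → Fin n → ℝ} :
    x ∈ TeslerPolytope n a ↔ (∀ i j : Fin n, j < i → x i j = 0) ∧ (∀ i j : Fin n, 0 ≤ x i j) ∧
      hookSum n x = fun k => (a k : ℝ) := by
  constructor
  · rintro ⟨h1, h2, h3⟩
    refine ⟨h1, fun i j => ?_, funext h3⟩
    rcases lt_or_ge j i with h | h
    · rw [h1 i j h]
    · exact h2 i j h
  · rintro ⟨h1, h2, h3⟩
    exact ⟨h1, fun i j _ => h2 i j, congrFun h3⟩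

theorem sub_mem_circulations {n : ℕ} {a : Fin n → ℕ} {x y : Fin n → Fin n → ℝ}
    (hx : x ∈ TeslerPolytope n a) (hy : y ∈ TeslerPolytope n a) : x - y ∈ circulations n := by
  rw [mem_teslerPolytope] at hx hy
  exact ⟨fun i j h => by simp [hx.1 i j h, hy.1 i j h], by rw [map_sub, hx.2.2, hy.2.2, sub_self]⟩

/-- Conservation at node `k` of a circulation. -/
theorem sum_row_eq_sum_col {n : ℕ} {d : Fin n → Fin n → ℝ} (hd : d ∈ circulations n) (k : Fin n) :
    ∑ j ∈ univ.filter (fun j => k ≤ j), d k j = ∑ i ∈ univ.filter (fun i => i < k), d i k :=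
  sub_eq_zero.1 (congrFun hd.2 k)

/-- If row `k` of an upper triangular matrix vanishes off `(k, s)`, its row sum is that entry. -/
theorem sum_row_eq_single {n : ℕ} {d : Fin n → Fin n → ℝ} {k s : Fin n} (hs : k ≤ s)
    (h : ∀ t, t ≠ s → d k t = 0) : ∑ j ∈ univ.filter (fun j => k ≤ j), d k j = d k s :=
  Finset.sum_eq_single s (fun t _ ht => h t ht) fun h' => absurd (by simpa using hs) h'

theorem circulation_eq_zero {n : ℕ} {f : Fin n → Fin n} (hf : ∀ k, k ≤ f k)
    {d : Fin n → Fin n → ℝ} (hd : hookSum n d = 0) (h : ∀ k t, t ≠ f k → d k t = 0) : d = 0 := by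
  have key : ∀ k, ∀ t, d k t = 0 := by
    intro k
    induction k using WellFoundedLT.induction with
    | ind k ih =>
      intro t
      by_cases ht : t = f k
      · have h1 : (∑ j ∈ univ.filter (fun j => k ≤ j), d k j)
           - (∑ i ∈ univ.filter (fun i => i < k), d i k) = 0 := congrFun hd k
        rw [sum_row_eq_single (hf k) (h k), Finset.sum_eq_zero, sub_zero] at h1
        · rw [ht, h1]
        · intro i hi
          exact ih i (by simpa using hi) k
      · exact h k t ht
  funext k t
  exact key k t

/-- The entries off the graph of `f` and the hook sums can be prescribed arbitrarily. -/
theorem exists_hookSum_eq {n : ℕ} {f : Fin n → Fin n} (hf : ∀ k, k ≤ f k)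
    (u : Fin n → Fin n → ℝ) (c : Fin n → ℝ) :
    ∃ d : Fin n → Fin n → ℝ, hookSum n d = c ∧ ∀ k t, t ≠ f k → d k t = u k t := by
  let Ψ : (Fin n → Fin n → ℝ) →ₗ[ℝ] (Fin n → Fin n → ℝ) :=
    { toFun := fun x k t => if t = f k then hookSum n x k else x k t
      map_add' := fun x y => by
        funext k t
        simp only [map_add, Pi.add_apply]
        split_ifs <;> rfl
      map_smul' := fun c x => by
        funext k t
        simp only [map_smul, Pi.smul_apply, RingHom.id_apply]
        split_ifs <;> rfl }
  have hΨ : ∀ x k t, Ψ x k t = if t = f k then hookSum n x k else x k t := fun _ _ _ => rfl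
  have hinj : Function.Injective Ψ := by
    rw [injective_iff_map_eq_zero]
    intro d hd
    refine circulation_eq_zero hf ?_ fun k t ht => ?_
    · funext k
      have := congrFun (congrFun hd k) (f k)
      rwa [hΨ, if_pos rfl] at this
    · have := congrFun (congrFun hd k) t
      rwa [hΨ, if_neg ht] at this
  obtain ⟨d, hd⟩ := LinearMap.injective_iff_surjective.1 hinj
    (fun k t => if t = f k then c k else u k t)
  refine ⟨d, ?_, fun k t ht => ?_⟩
  · funext k
    have := congrFun (congrFun hd k) (f k)
    rwa [hΨ, if_pos rfl, if_pos rfl] at this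
  · have := congrFun (congrFun hd k) t
    rwa [hΨ, if_neg ht, if_neg ht] at this

theorem eventually_add_smul_mem {n : ℕ} {a : Fin n → ℕ} {v d : Fin n → Fin n → ℝ}
    (hv : v ∈ TeslerPolytope n a) (hd : d ∈ circulations n)
    (hpos : ∀ i j, v i j = 0 → 0 ≤ d i j) :
    ∀ᶠ ε : ℝ in nhdsWithin 0 (Set.Ioi 0), v + ε • d ∈ TeslerPolytope n a := by
  have hv' := mem_teslerPolytope.1 hv
  have h : ∀ i j, ∀ᶠ ε : ℝ in nhdsWithin 0 (Set.Ioi 0), 0 ≤ v i j + ε * d i j := by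
    intro i j
    rcases (hv'.2.1 i j).eq_or_lt with h0 | h0
    · filter_upwards [self_mem_nhdsWithin] with ε hε
      rw [← h0, zero_add]
      exact mul_nonneg (le_of_lt hε) (hpos i j h0.symm)
    · have hc : Filter.Tendsto (fun ε : ℝ => v i j + ε * d i j) (nhds 0)
          (nhds (v i j + 0 * d i j)) := Continuous.tendsto (by fun_prop) 0
      rw [zero_mul, add_zero] at hc
      filter_upwards [nhdsWithin_le_nhds (hc.eventually (lt_mem_nhds h0))] with ε hε
      exact hε.le
  filter_upwards [Filter.eventually_all.2 fun i => Filter.eventually_all.2 (h i)] with ε hε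
  rw [mem_teslerPolytope]
  refine ⟨fun i j hij => ?_, hε, ?_⟩
  · simp [hv'.1 i j hij, hd.1 i j hij]
  · rw [map_add, map_smul, hd.2, hv'.2.2, smul_zero, add_zero]

theorem simple_at_iff_linearIndependent {n : ℕ} {a : Fin n → ℕ} {v : Fin n → Fin n → ℝ}
    (hv : v ∈ TeslerPolytope n a) {ι : Type*} [Fintype ι] (g : ι → Fin n → Fin n → ℝ)
    (hg : ∀ i, g i ∈ circulations n) (hpos : ∀ i k t, v k t = 0 → 0 ≤ g i k t)
    (hgen : ∀ x ∈ TeslerPolytope n a, ∃ c : ι → ℝ, (∀ i, 0 ≤ c i) ∧ x - v = ∑ i, c i • g i)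
    (hsep : ∀ i j, j ≠ i → ∃ k t, v k t = 0 ∧ g i k t = 0 ∧ 0 < g j k t)
    (hne : ∀ i, g i ≠ 0) :
    ({F : Set (Fin n → Fin n → ℝ) | F.Nonempty ∧ IsExposed ℝ (TeslerPolytope n a) F ∧
        Module.finrank ℝ (affineSpan ℝ F).direction = 1 ∧ v ∈ F}).ncard =
      Module.finrank ℝ (affineSpan ℝ (TeslerPolytope n a)).direction ↔
      LinearIndependent ℝ g := by
  classical
  refine ncard_edges_eq_finrank_iff hv g (fun i => ?_) (fun x hx => ?_) (fun i => ?_) hne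
  · obtain ⟨ε, h, hε⟩ :=
      ((eventually_add_smul_mem hv (hg i) (hpos i)).and self_mem_nhdsWithin).exists
    exact ⟨ε, hε, h⟩
  · obtain ⟨c, hc, h⟩ := hgen x hx
    exact ⟨c, hc, by rw [← h, add_sub_cancel]⟩
  · let l : StrongDual ℝ (Fin n → Fin n → ℝ) :=
      -∑ p ∈ univ.filter (fun p : Fin n × Fin n => v p.1 p.2 = 0 ∧ g i p.1 p.2 = 0),
        (ContinuousLinearMap.proj (R := ℝ) (φ := fun _ : Fin n => ℝ) p.2).comp
          (ContinuousLinearMap.proj (R := ℝ) (φ := fun _ : Fin n => Fin n → ℝ) p.1)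
    have hl : ∀ x, l x = -∑ p ∈ univ.filter
        (fun p : Fin n × Fin n => v p.1 p.2 = 0 ∧ g i p.1 p.2 = 0), x p.1 p.2 := by
      intro x
      simp [l]
    refine ⟨l, ?_, fun j hj => ?_⟩
    · rw [hl, neg_eq_zero]
      exact Finset.sum_eq_zero fun p hp => (Finset.mem_filter.1 hp).2.2
    · rw [hl, neg_lt_zero]
      obtain ⟨k, t, h1, h2, h3⟩ := hsep i j hj
      refine Finset.sum_pos' (fun p hp => hpos j _ _ (Finset.mem_filter.1 hp).2.1)
        ⟨(k, t), by simp [h1, h2], h3⟩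

theorem eq_zero_of_mem_extremePoints {n : ℕ} {a : Fin n → ℕ} {v d : Fin n → Fin n → ℝ}
    (hv : v ∈ Set.extremePoints ℝ (TeslerPolytope n a)) (hd : d ∈ circulations n)
    (h : ∀ i j, v i j = 0 → d i j = 0) : d = 0 := by
  have h1 := eventually_add_smul_mem hv.1 hd fun i j hij => (h i j hij).ge
  have h2 := eventually_add_smul_mem hv.1 (Submodule.neg_mem _ hd) fun i j hij => by
    simp [h i j hij]
  obtain ⟨ε, ⟨h1, h2⟩, hε⟩ := ((h1.and h2).and self_mem_nhdsWithin).exists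
  have h3 := hv.2 h1 h2 ⟨1 / 2, 1 / 2, by norm_num, by norm_num, by norm_num, by
    rw [smul_neg]; module⟩
  have h4 : ε • d = 0 := by simpa using h3
  exact (smul_eq_zero.1 h4).resolve_left (ne_of_gt hε)

theorem mem_extremePoints_of_support {n : ℕ} {a : Fin n → ℕ} {v : Fin n → Fin n → ℝ}
    (hv : v ∈ TeslerPolytope n a) {f : Fin n → Fin n} (hf : ∀ k, k ≤ f k)
    (h : ∀ k t, t ≠ f k → v k t = 0) : v ∈ Set.extremePoints ℝ (TeslerPolytope n a) := by
  refine ⟨hv, fun x hx y hy hxy => ?_⟩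
  obtain ⟨α, β, hα, hβ, -, hxy⟩ := hxy
  refine sub_eq_zero.1 (circulation_eq_zero hf (sub_mem_circulations hx hv).2 fun k t ht => ?_)
  have h1 := congrFun (congrFun hxy k) t
  simp only [Pi.add_apply, Pi.smul_apply, smul_eq_mul, h k t ht] at h1
  have hx0 := (mem_teslerPolytope.1 hx).2.1 k t
  have hy0 := (mem_teslerPolytope.1 hy).2.1 k t
  have h2 := mul_nonneg hβ.le hy0
  have h3 := mul_nonneg hα.le hx0
  have h4 : α * x k t = 0 := by linarith
  simp [h k t ht, (mul_eq_zero.1 h4).resolve_left hα.ne']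

theorem col_eq_zero {n : ℕ} {a : Fin n → ℕ} {v : Fin n → Fin n → ℝ}
    (hv : v ∈ TeslerPolytope n a) {k : Fin n} (h : ∀ t, v k t = 0) :
    a k = 0 ∧ ∀ i, i < k → v i k = 0 := by
  rw [mem_teslerPolytope] at hv
  have h1 := congrFun hv.2.2 k
  rw [hookSum_apply, Finset.sum_eq_zero (fun j _ => h j)] at h1
  have h2 : 0 ≤ ∑ i ∈ univ.filter (fun i => i < k), v i k :=
    Finset.sum_nonneg fun i _ => hv.2.1 i k
  have h3 : (0 : ℝ) ≤ a k := Nat.cast_nonneg _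
  refine ⟨by exact_mod_cast (by linarith : (a k : ℝ) = 0), fun i hi => ?_⟩
  have h4 : ∑ i ∈ univ.filter (fun i => i < k), v i k = 0 := by linarith
  exact (Finset.sum_eq_zero_iff_of_nonneg fun i _ => hv.2.1 i k).1 h4 i (by simpa using hi)

/-- A vertex has at most one nonzero entry in each row. -/
theorem exists_support_of_mem_extremePoints {n : ℕ} {a : Fin n → ℕ} {v : Fin n → Fin n → ℝ}
    (hv : v ∈ Set.extremePoints ℝ (TeslerPolytope n a)) :
    ∃ f : Fin n → Fin n, (∀ k, k ≤ f k) ∧ (∀ k t, t ≠ f k → v k t = 0) ∧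
      ∀ k, v k (f k) = 0 → f k = k := by
  classical
  have hvP := mem_teslerPolytope.1 hv.1
  have hex : ∀ k, ∃ s, k ≤ s ∧ (v k s = 0 → s = k ∧ ∀ t, v k t = 0) := by
    intro k
    by_cases h : ∃ t, v k t ≠ 0
    · obtain ⟨t, ht⟩ := h
      exact ⟨t, not_lt.1 fun h' => ht (hvP.1 k t h'), fun h' => absurd h' ht⟩
    · push Not at h
      exact ⟨k, le_rfl, fun _ => ⟨rfl, h⟩⟩
  choose f hf hf0 using hex
  refine ⟨f, hf, fun k s hs => ?_, fun k h => (hf0 k h).1⟩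
  by_contra hvs
  obtain ⟨d, hd, hdu⟩ := exists_hookSum_eq hf
    (fun i j => if i = k ∧ j = s then (1 : ℝ) else 0) 0
  have hks : k ≤ s := not_lt.1 fun h' => hvs (hvP.1 k s h')
  have hdV : d ∈ circulations n := by
    refine ⟨fun i j hij => ?_, hd⟩
    rw [hdu i j (ne_of_lt (hij.trans_le (hf i)))]
    refine if_neg ?_
    rintro ⟨rfl, rfl⟩
    exact absurd hij (not_lt.2 hks)
  have hd0 : d = 0 := by
    refine eq_zero_of_mem_extremePoints hv hdV fun i j hij => ?_
    have hoff : ∀ p q, v p q = 0 → q ≠ f p → d p q = 0 := by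
      intro p q hpq hq
      rw [hdu p q hq]
      refine if_neg ?_
      rintro ⟨rfl, rfl⟩
      exact hvs hpq
    by_cases hj : j = f i
    · subst hj
      obtain ⟨hfi, hrow⟩ := hf0 i hij
      rw [← sum_row_eq_single (hf i) fun t ht => hoff i t (hrow t) ht, sum_row_eq_sum_col hdV]
      refine Finset.sum_eq_zero fun p hp => ?_
      have hp : p < i := by simpa using hp
      have hpi := (col_eq_zero hv.1 hrow).2 p hp
      refine hoff p i hpi fun h' => ?_
      have := (hf0 p (h' ▸ hpi)).1
      exact hp.ne (this.symm.trans h'.symm)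
    · exact hoff i j hij hj
  have := hdu k s hs
  simp [hd0] at this

theorem simple_at_of_orthant {n : ℕ} {a : Fin n → ℕ} {v : Fin n → Fin n → ℝ}
    (hv : v ∈ TeslerPolytope n a) {f : Fin n → Fin n} (hf : ∀ k, k ≤ f k)
    (hoff : ∀ k t, t ≠ f k → v k t = 0)
    (hcone : ∀ d ∈ circulations n, (∀ k t, t ≠ f k → 0 ≤ d k t) →
      ∀ k t, v k t = 0 → 0 ≤ d k t) :
    ({F : Set (Fin n → Fin n → ℝ) | F.Nonempty ∧ IsExposed ℝ (TeslerPolytope n a) F ∧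
        Module.finrank ℝ (affineSpan ℝ F).direction = 1 ∧ v ∈ F}).ncard =
      Module.finrank ℝ (affineSpan ℝ (TeslerPolytope n a)).direction := by
  classical
  let ι := {p : Fin n × Fin n // p.1 ≤ p.2 ∧ p.2 ≠ f p.1}
  have hex : ∀ p : ι, ∃ d : Fin n → Fin n → ℝ, d ∈ circulations n ∧
      ∀ k t, t ≠ f k → d k t = if k = p.1.1 ∧ t = p.1.2 then 1 else 0 := by
    intro p
    obtain ⟨d, hd, hdu⟩ := exists_hookSum_eq hf
      (fun k t => if k = p.1.1 ∧ t = p.1.2 then (1 : ℝ) else 0) 0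
    refine ⟨d, ⟨fun i j hij => ?_, hd⟩, hdu⟩
    rw [hdu i j (ne_of_lt (hij.trans_le (hf i)))]
    refine if_neg ?_
    rintro ⟨rfl, rfl⟩
    exact absurd hij (not_lt.2 p.2.1)
  choose g hg hgu using hex
  have hself : ∀ p : ι, g p p.1.1 p.1.2 = 1 := fun p => by
    rw [hgu p _ _ p.2.2, if_pos ⟨rfl, rfl⟩]
  have hother : ∀ p q : ι, q ≠ p → g p q.1.1 q.1.2 = 0 := fun p q h => by
    rw [hgu p _ _ q.2.2, if_neg]
    rintro ⟨h1, h2⟩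
    exact h (Subtype.ext (Prod.ext h1 h2))
  have hsum : ∀ (c : ι → ℝ) (q : ι), (∑ p, c p • g p) q.1.1 q.1.2 = c q := by
    intro c q
    simp only [Finset.sum_apply, Pi.smul_apply, smul_eq_mul]
    rw [Finset.sum_eq_single q, hself, mul_one]
    · intro p _ hp
      rw [hother p q hp.symm, mul_zero]
    · simp
  refine (simple_at_iff_linearIndependent hv g hg (fun p => ?_) (fun x hx => ?_)
    (fun p q hpq => ?_) fun p h => ?_).2 ?_
  · refine hcone _ (hg p) fun k t ht => ?_
    rw [hgu p k t ht]
    split_ifs <;> norm_num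
  · refine ⟨fun p => x p.1.1 p.1.2, fun p => (mem_teslerPolytope.1 hx).2.1 _ _, ?_⟩
    have hV := sub_mem_circulations hx hv
    have hW : x - v - ∑ p : ι, x p.1.1 p.1.2 • g p ∈ circulations n :=
      Submodule.sub_mem _ hV (Submodule.sum_mem _ fun p _ => Submodule.smul_mem _ _ (hg p))
    refine sub_eq_zero.1 (circulation_eq_zero hf hW.2 fun k t ht => ?_)
    rcases lt_or_ge t k with h | h
    · exact hW.1 k t h
    · have := hsum (fun p => x p.1.1 p.1.2) ⟨(k, t), h, ht⟩
      dsimp only at this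
      rw [Pi.sub_apply, Pi.sub_apply, this]
      simp [hoff k t ht]
  · exact ⟨q.1.1, q.1.2, hoff _ _ q.2.2, hother p q hpq, by rw [hself]; norm_num⟩
  · have := hself p
    simp [h] at this
  · rw [Fintype.linearIndependent_iff]
    intro c hc q
    rw [← hsum c q, hc]
    rfl

/-- Index set of the edge directions at a vertex whose only idle node is `j`: single arcs avoiding
`j`, and pairs of arcs passing through `j`. -/
abbrev DetourIndex {n : ℕ} (f : Fin n → Fin n) (j : Fin n) : Type :=
  {p : Fin n × Fin n // p.1 ≤ p.2 ∧ p.2 ≠ f p.1 ∧ p.1 ≠ j ∧ p.2 ≠ j} ⊕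
    ({k : Fin n // k < j} × {t : Fin n // j ≤ t})

/-- The entries off the graph of `f` of the edge direction with the given index. -/
def detourEntry {n : ℕ} (f : Fin n → Fin n) (j : Fin n) : DetourIndex f j → Fin n → Fin n → ℝ
  | .inl p => fun k t => if k = p.1.1 ∧ t = p.1.2 then 1 else 0
  | .inr q => fun k t =>
      (if k = q.1.1 ∧ t = j then 1 else 0) + (if k = j ∧ t = q.2.1 then 1 else 0)

theorem detourEntry_nonneg {n : ℕ} (f : Fin n → Fin n) (j : Fin n) (i : DetourIndex f j)
    (k t : Fin n) : 0 ≤ detourEntry f j i k t := by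
  rcases i with p | q
  · simp only [detourEntry]
    split_ifs <;> norm_num
  · simp only [detourEntry]
    split_ifs <;> norm_num

theorem exists_detour {n : ℕ} {f : Fin n → Fin n} (hf : ∀ k, k ≤ f k) {j : Fin n} (hfj : f j = j)
    (hfne : ∀ k, k < j → f k ≠ j) (i : DetourIndex f j) :
    ∃ d ∈ circulations n, ∀ k t, (t ≠ f k ∨ k = j) → d k t = detourEntry f j i k t := by
  classical
  obtain ⟨d, hd, hdu⟩ := exists_hookSum_eq hf (detourEntry f j i) 0
  have hdV : d ∈ circulations n := by
    refine ⟨fun k t hkt => ?_, hd⟩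
    rw [hdu k t (ne_of_lt (hkt.trans_le (hf k)))]
    rcases i with p | q
    · refine if_neg ?_
      rintro ⟨rfl, rfl⟩
      exact absurd hkt (not_lt.2 p.2.1)
    · simp only [detourEntry]
      rw [if_neg, if_neg, add_zero]
      · rintro ⟨rfl, rfl⟩
        exact absurd hkt (not_lt.2 q.2.2)
      · rintro ⟨rfl, rfl⟩
        exact absurd hkt (not_lt.2 q.1.2.le)
  refine ⟨d, hdV, fun k t hkt => ?_⟩
  by_cases ht : t = f k
  · obtain rfl : k = j := hkt.resolve_left (not_not.2 ht)
    obtain rfl : t = k := ht.trans hfj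
    have h1 := sum_row_eq_sum_col hdV t
    have h2 : ∑ b ∈ univ.filter (fun b => t ≤ b), detourEntry f t i t b =
        ∑ b ∈ univ.filter (fun b => b < t), detourEntry f t i b t := by
      rcases i with p | q
      · rw [Finset.sum_eq_zero, Finset.sum_eq_zero]
        · exact fun b _ => if_neg fun h => p.2.2.2.2 h.2.symm
        · exact fun b _ => if_neg fun h => p.2.2.2.1 h.1.symm
      · simp only [detourEntry, Finset.sum_add_distrib, Finset.sum_filter]
        have h3 := q.1.2
        have h4 := q.2.2
        rw [Finset.sum_eq_zero, Finset.sum_eq_single q.2.1, Finset.sum_eq_single q.1.1,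
          Finset.sum_eq_zero]
        · simp [h3, h4]
        · intro b _
          split_ifs with h5 h6
          · exact absurd h6.1 h5.ne
          · rfl
          · rfl
        · intro b _ hb
          simp [hb]
        · simp
        · intro b _ hb
          simp [hb]
        · simp
        · intro b _
          split_ifs with h5 h6
          · exact absurd h6.1 h3.ne'
          · rfl
          · rfl
    have h3 : ∑ b ∈ univ.filter (fun b => b < t), d b t =
        ∑ b ∈ univ.filter (fun b => b < t), detourEntry f t i b t :=
      Finset.sum_congr rfl fun b hb => hdu b t (hfne b (by simpa using hb)).symm
    rw [h3, ← h2, ← Finset.add_sum_erase _ _ (show t ∈ univ.filter (fun b => t ≤ b) by simp),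
      ← Finset.add_sum_erase _ _ (show t ∈ univ.filter (fun b => t ≤ b) by simp)] at h1
    have h4 : ∑ b ∈ (univ.filter (fun b => t ≤ b)).erase t, d t b =
        ∑ b ∈ (univ.filter (fun b => t ≤ b)).erase t, detourEntry f t i t b :=
      Finset.sum_congr rfl fun b hb => hdu t b (by rw [hfj]; exact (Finset.mem_erase.1 hb).1)
    rw [h4] at h1
    exact add_right_cancel h1
  · exact hdu k t ht

theorem exists_detour_decomposition {n : ℕ} (f : Fin n → Fin n) {j : Fin n}
    {d : Fin n → Fin n → ℝ} (hd : d ∈ circulations n)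
    (hpos : ∀ k t, (t ≠ f k ∨ k = j) → 0 ≤ d k t) (hfne : ∀ k, k < j → f k ≠ j) :
    ∃ c : DetourIndex f j → ℝ, (∀ i, 0 ≤ c i) ∧
      ∀ k t, t ≠ f k → d k t = ∑ i, c i * detourEntry f j i k t := by
  classical
  set s := ∑ i ∈ univ.filter (fun i => i < j), d i j with hs
  have hcolpos : ∀ i, i < j → 0 ≤ d i j := fun i hi => hpos i j (.inl (hfne i hi).symm)
  have hs0 : 0 ≤ s := Finset.sum_nonneg fun i hi => hcolpos i (by simpa using hi)
  have hs' : ∑ t ∈ univ.filter (fun t => j ≤ t), d j t = s := sum_row_eq_sum_col hd j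
  have hcol : ∑ k : {k : Fin n // k < j}, d k.1 j = s := by
    rw [hs]
    exact (Finset.sum_subtype _ (by simp) fun i => d i j).symm
  have hrow : ∑ t : {t : Fin n // j ≤ t}, d j t.1 = s := by
    rw [← hs']
    exact (Finset.sum_subtype _ (by simp) fun i => d j i).symm
  have hcol0 : s = 0 → ∀ k : {k : Fin n // k < j}, d k.1 j = 0 := fun h k =>
    (Finset.sum_eq_zero_iff_of_nonneg fun k _ => hcolpos k.1 k.2).1 (hcol.trans h) k (mem_univ _)
  have hrow0 : s = 0 → ∀ t : {t : Fin n // j ≤ t}, d j t.1 = 0 := fun h t =>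
    (Finset.sum_eq_zero_iff_of_nonneg fun t _ => hpos j t.1 (.inr rfl)).1 (hrow.trans h) t
      (mem_univ _)
  refine ⟨Sum.elim (fun p => d p.1.1 p.1.2) (fun q => d q.1.1 j * d j q.2.1 / s), ?_, ?_⟩
  · rintro (p | q)
    · exact hpos _ _ (.inl p.2.2.1)
    · exact div_nonneg (mul_nonneg (hcolpos _ q.1.2) (hpos _ _ (.inr rfl))) hs0
  · intro k t hkt
    rw [Fintype.sum_sum_type, Fintype.sum_prod_type]
    simp only [Sum.elim_inl, Sum.elim_inr, detourEntry]
    by_cases hk : k = j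
    · subst hk
      rw [Fintype.sum_eq_zero, zero_add]
      · have h1 : ∀ (b : {b : Fin n // b < k}) (e : {e : Fin n // k ≤ e}),
            d b.1 k * d k e.1 / s * ((if k = b.1 ∧ t = k then 1 else 0) +
              (if k = k ∧ t = e.1 then 1 else 0)) =
            if t = e.1 then d b.1 k * d k t / s else 0 := by
          intro b e
          rw [if_neg fun h => b.2.ne' h.1, zero_add]
          by_cases he : t = e.1 <;> simp [he]
        rw [Finset.sum_congr rfl fun b _ => Finset.sum_congr rfl fun e _ => h1 b e]
        rcases lt_or_ge t k with h | h
        · rw [hd.1 k t h]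
          simp
        · have h2 : ∀ b : {b : Fin n // b < k},
              (∑ e : {e : Fin n // k ≤ e}, if t = e.1 then d b.1 k * d k t / s else 0) =
              d b.1 k * d k t / s := by
            intro b
            rw [Fintype.sum_eq_single (⟨t, h⟩ : {e : Fin n // k ≤ e})]
            · simp
            · exact fun e he => if_neg fun h' => he (Subtype.ext h'.symm)
          rw [Finset.sum_congr rfl fun b _ => h2 b, ← Finset.sum_div, ← Finset.sum_mul, hcol]
          by_cases h0 : s = 0
          · simp [h0, hrow0 h0 ⟨t, h⟩]
          · field_simp
      · exact fun p => by rw [if_neg fun h => p.2.2.2.1 h.1.symm, mul_zero]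
    · by_cases ht : t = j
      · subst ht
        rw [Fintype.sum_eq_zero, zero_add]
        · simp only [hk, false_and, if_false, add_zero, and_true]
          rcases lt_or_ge k t with h | h
          · rw [Fintype.sum_eq_single (⟨k, h⟩ : {b : Fin n // b < t})]
            · simp only [if_true, mul_one]
              rw [← Finset.sum_div, ← Finset.mul_sum, hrow]
              by_cases h0 : s = 0
              · simp [h0, hcol0 h0 ⟨k, h⟩]
              · field_simp
            · intro b hb
              refine Fintype.sum_eq_zero _ fun e => ?_
              rw [if_neg fun h' => hb (Subtype.ext h'.symm), mul_zero]
          · rw [hd.1 k t (lt_of_le_of_ne h (Ne.symm hk)), Fintype.sum_eq_zero]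
            intro b
            refine Fintype.sum_eq_zero _ fun e => ?_
            have hb : k ≠ b.1 := fun h' => absurd b.2 (not_lt.2 (h' ▸ h))
            rw [if_neg hb, mul_zero]
        · exact fun p => by rw [if_neg fun h => p.2.2.2.2 h.2.symm, mul_zero]
      · simp only [hk, ht, false_and, and_false, if_false, add_zero, mul_zero,
          Finset.sum_const_zero]
        rcases lt_or_ge t k with h | h
        · rw [hd.1 k t h, Fintype.sum_eq_zero]
          intro p
          rw [if_neg, mul_zero]
          rintro ⟨rfl, rfl⟩
          exact absurd h (not_lt.2 p.2.1)
        · rw [Fintype.sum_eq_single ⟨(k, t), h, hkt, hk, ht⟩]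
          · simp
          · intro p hp
            rw [if_neg, mul_zero]
            rintro ⟨h1, h2⟩
            exact hp (Subtype.ext (Prod.ext h1.symm h2.symm))

/-- At a vertex whose only idle node is `j`, the edge directions are the detours. -/
theorem simple_at_iff_detours {n : ℕ} {a : Fin n → ℕ} {v : Fin n → Fin n → ℝ}
    (hv : v ∈ TeslerPolytope n a) {f : Fin n → Fin n} (hf : ∀ k, k ≤ f k) {j : Fin n}
    (hfj : f j = j) (hfne : ∀ k, k < j → f k ≠ j)
    (hoff : ∀ k t, (t ≠ f k ∨ k = j) → v k t = 0)
    (hcone : ∀ d ∈ circulations n, (∀ k t, (t ≠ f k ∨ k = j) → 0 ≤ d k t) →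
      ∀ k t, v k t = 0 → 0 ≤ d k t) :
    ∃ g : DetourIndex f j → Fin n → Fin n → ℝ, (∀ i, g i ∈ circulations n) ∧
      (∀ i k t, (t ≠ f k ∨ k = j) → g i k t = detourEntry f j i k t) ∧
      (({F : Set (Fin n → Fin n → ℝ) | F.Nonempty ∧ IsExposed ℝ (TeslerPolytope n a) F ∧
        Module.finrank ℝ (affineSpan ℝ F).direction = 1 ∧ v ∈ F}).ncard =
      Module.finrank ℝ (affineSpan ℝ (TeslerPolytope n a)).direction ↔
      LinearIndependent ℝ g) := by
  classical
  choose g hg hgu using exists_detour hf hfj hfne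
  refine ⟨g, hg, hgu, simple_at_iff_linearIndependent hv g hg (fun i => ?_) (fun x hx => ?_)
    (fun i i' hii' => ?_) fun i h => ?_⟩
  · refine hcone _ (hg i) fun k t ht => ?_
    rw [hgu i k t ht]
    exact detourEntry_nonneg f j i k t
  · have hV := sub_mem_circulations hx hv
    obtain ⟨c, hc, hdec⟩ := exists_detour_decomposition f hV (fun k t hkt => by
      rw [Pi.sub_apply, Pi.sub_apply, hoff k t hkt, sub_zero]
      exact (mem_teslerPolytope.1 hx).2.1 k t) hfne
    refine ⟨c, hc, sub_eq_zero.1 (circulation_eq_zero hf (Submodule.sub_mem _ hV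
      (Submodule.sum_mem _ fun i _ => Submodule.smul_mem _ (c i) (hg i))).2 fun k t ht => ?_)⟩
    rw [Pi.sub_apply, Pi.sub_apply, hdec k t ht, sub_eq_zero]
    simp only [Finset.sum_apply, Pi.smul_apply, smul_eq_mul]
    exact Finset.sum_congr rfl fun i _ => by rw [hgu i k t (.inl ht)]
  · suffices h : ∃ k t, (t ≠ f k ∨ k = j) ∧ detourEntry f j i k t = 0 ∧
        0 < detourEntry f j i' k t by
      obtain ⟨k, t, h1, h2, h3⟩ := h
      exact ⟨k, t, hoff k t h1, by rw [hgu i k t h1, h2], by rwa [hgu i' k t h1]⟩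
    rcases i' with p | q
    · refine ⟨p.1.1, p.1.2, .inl p.2.2.1, ?_, by simp [detourEntry]⟩
      rcases i with p' | q'
      · refine if_neg ?_
        rintro ⟨h1, h2⟩
        exact hii' (congrArg Sum.inl (Subtype.ext (Prod.ext h1 h2)))
      · simp [detourEntry, p.2.2.2.1, p.2.2.2.2]
    · rcases i with p' | q'
      · refine ⟨q.1.1, j, .inl (hfne _ q.1.2).symm, if_neg fun h => p'.2.2.2.2 h.2.symm, ?_⟩
        simp [detourEntry, q.1.2.ne]
      · by_cases hq : q.1 = q'.1
        · have hq2 : q.2.1 ≠ q'.2.1 := fun h =>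
            hii' (congrArg Sum.inr (Prod.ext hq (Subtype.ext h)))
          refine ⟨j, q.2.1, .inr rfl, ?_, ?_⟩
          · simp [detourEntry, q'.1.2.ne', hq2]
          · simp [detourEntry, q.1.2.ne']
        · have hq1 : q.1.1 ≠ q'.1.1 := fun h => hq (Subtype.ext h)
          refine ⟨q.1.1, j, .inl (hfne _ q.1.2).symm, ?_, ?_⟩
          · simp [detourEntry, q.1.2.ne, hq1]
          · simp [detourEntry, q.1.2.ne]
  · rcases i with p | q
    · have := hgu (.inl p) p.1.1 p.1.2 (.inl p.2.2.1)
      simp [h, detourEntry] at this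
    · have := hgu (.inr q) j q.2.1 (.inr rfl)
      simp [h, detourEntry, q.1.2.ne'] at this

theorem not_isSimplePolytope_of_eq_zero {n : ℕ} (hn : 0 < n) {a : Fin n → ℕ}
    (ha : 0 < a ⟨0, hn⟩) {j : Fin n} (hj : 2 ≤ (j : ℕ)) (hjn : (j : ℕ) + 1 < n) (haj : a j = 0) :
    ¬ IsSimplePolytope (TeslerPolytope n a) := by
  classical
  -- the vertex whose flow runs through all the nodes except `j`
  have hfex : ∃ f : Fin n → Fin n, (∀ k, k ≤ f k) ∧ f j = j ∧ (∀ k, k < j → f k ≠ j) ∧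
      ∀ k : Fin n, k ≠ j → 0 < (k : ℕ) → ∃ i, i < k ∧ i ≠ j ∧ f i = k := by
    refine ⟨fun k => if k = j then j else if (k : ℕ) + 1 = j then ⟨j + 1, hjn⟩ else
      if h : (k : ℕ) + 1 < n then ⟨k + 1, h⟩ else k, fun k => ?_, by simp, fun k hk => ?_,
      fun k hkj hk => ?_⟩
    · dsimp only
      split_ifs with h1 h2 h3
      · exact h1.le
      · exact Fin.le_def.2 (by simp; omega)
      · exact Fin.le_def.2 (by simp)
      · exact le_rfl
    · rw [Fin.lt_def] at hk
      simp only [Fin.ext_iff, ne_eq]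
      split_ifs <;> first | omega | simp
    · have hkj' : (k : ℕ) ≠ j := fun h => hkj (Fin.ext h)
      have hkn := k.2
      by_cases h : (k : ℕ) = j + 1
      · refine ⟨⟨j - 1, by omega⟩, ?_, ?_, ?_⟩
        · rw [Fin.lt_def]; simp; omega
        · simp only [Fin.ext_iff, ne_eq]; omega
        · simp only [Fin.ext_iff]
          rw [if_neg (by omega), if_pos (by omega)]
          exact h.symm
      · refine ⟨⟨k - 1, by omega⟩, ?_, ?_, ?_⟩
        · rw [Fin.lt_def]; simp; omega
        · simp only [Fin.ext_iff, ne_eq]; omega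
        · simp only [Fin.ext_iff]
          rw [if_neg (by omega), if_neg (by omega), dif_pos (by omega)]
          exact Nat.sub_add_cancel hk
  obtain ⟨f, hf, hfj, hfne, hpred⟩ := hfex
  obtain ⟨v, hv, hvu⟩ := exists_hookSum_eq hf 0 fun k => (a k : ℝ)
  replace hvu : ∀ k t, t ≠ f k → v k t = 0 := hvu
  have hrec : ∀ k, v k (f k) = a k + ∑ i ∈ univ.filter (fun i => i < k), v i k := by
    intro k
    have h := congrFun hv k
    rw [hookSum_apply, sum_row_eq_single (hf k) (hvu k)] at h
    linarith
  have hpos : ∀ k, (∀ t, 0 ≤ v k t) ∧ (k ≠ j → 0 < v k (f k)) := by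
    intro k
    induction k using WellFoundedLT.induction with
    | ind k ih =>
      have h0 : ∀ i ∈ univ.filter (fun i => i < k), 0 ≤ v i k := fun i hi =>
        (ih i (by simpa using hi)).1 k
      have h1 : (0 : ℝ) ≤ a k := Nat.cast_nonneg _
      refine ⟨fun t => ?_, fun hkj => ?_⟩
      · by_cases ht : t = f k
        · rw [ht, hrec]
          exact add_nonneg h1 (Finset.sum_nonneg h0)
        · exact (hvu k t ht).ge
      · rw [hrec]
        rcases Nat.eq_zero_or_pos (k : ℕ) with hk | hk
        · have : k = ⟨0, hn⟩ := Fin.ext hk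
          have h2 : (0 : ℝ) < a k := by rw [this]; exact_mod_cast ha
          exact add_pos_of_pos_of_nonneg h2 (Finset.sum_nonneg h0)
        · obtain ⟨i, hi, hij, hfi⟩ := hpred k hkj hk
          refine add_pos_of_nonneg_of_pos h1 (Finset.sum_pos' h0 ⟨i, by simpa using hi, ?_⟩)
          have := (ih i hi).2 hij
          rwa [hfi] at this
  have hvP : v ∈ TeslerPolytope n a := mem_teslerPolytope.2
    ⟨fun k t h => hvu k t (ne_of_lt (h.trans_le (hf k))), fun k => (hpos k).1, hv⟩
  have hoff : ∀ k t, (t ≠ f k ∨ k = j) → v k t = 0 := by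
    intro k t hkt
    by_cases ht : t = f k
    · obtain rfl : k = j := hkt.resolve_left (not_not.2 ht)
      rw [ht, hrec, haj, Nat.cast_zero, zero_add]
      exact Finset.sum_eq_zero fun i hi => hvu i k (hfne i (by simpa using hi)).symm
    · exact hvu k t ht
  obtain ⟨g, hg, hgu, hiff⟩ := simple_at_iff_detours hvP hf hfj hfne hoff
    fun d _ h k t hkt => h k t (by
      by_contra! hcon
      have := (hpos k).2 hcon.2
      rw [← hcon.1, hkt] at this
      exact lt_irrefl _ this)
  intro hsimple
  have hli := hiff.1 (hsimple v (mem_extremePoints_of_support hvP hf hvu))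
  have h0j : (⟨0, hn⟩ : Fin n) < j := Fin.lt_def.2 (by simp; omega)
  have h1j : (⟨1, by omega⟩ : Fin n) < j := Fin.lt_def.2 (by simp; omega)
  have hj1 : j ≤ (⟨j + 1, hjn⟩ : Fin n) := Fin.le_def.2 (by simp)
  let A : DetourIndex f j := .inr (⟨⟨0, hn⟩, h0j⟩, ⟨j, le_rfl⟩)
  let B : DetourIndex f j := .inr (⟨⟨1, by omega⟩, h1j⟩, ⟨⟨j + 1, hjn⟩, hj1⟩)
  let C : DetourIndex f j := .inr (⟨⟨0, hn⟩, h0j⟩, ⟨⟨j + 1, hjn⟩, hj1⟩)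
  let D : DetourIndex f j := .inr (⟨⟨1, by omega⟩, h1j⟩, ⟨j, le_rfl⟩)
  have hrel : g A + g B - (g C + g D) = 0 := by
    refine circulation_eq_zero hf (Submodule.sub_mem _ (Submodule.add_mem _ (hg A) (hg B))
      (Submodule.add_mem _ (hg C) (hg D))).2 fun k t ht => ?_
    simp only [Pi.sub_apply, Pi.add_apply]
    rw [hgu A k t (.inl ht), hgu B k t (.inl ht), hgu C k t (.inl ht), hgu D k t (.inl ht)]
    simp only [A, B, C, D, detourEntry]
    ring
  have hAB : A ≠ B := fun h => by simp [A, B, Fin.ext_iff] at h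
  have hAC : A ≠ C := fun h => by simp [A, C, Fin.ext_iff] at h
  have hAD : A ≠ D := fun h => by simp [A, D] at h
  have hc := Fintype.linearIndependent_iff.1 hli
    (Pi.single A 1 + Pi.single B 1 - (Pi.single C 1 + Pi.single D 1)) (by
      simp only [Pi.sub_apply, Pi.add_apply, sub_smul, add_smul, Finset.sum_sub_distrib,
        Finset.sum_add_distrib, Pi.single_apply, ite_smul, one_smul, zero_smul,
        Finset.sum_ite_eq', Finset.mem_univ, if_true]
      exact hrel) A
  simp [hAB, hAC, hAD] at hc

theorem linearIndependent_detours {n : ℕ} {f : Fin n → Fin n} {j : Fin n} (hj : (j : ℕ) = 1)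
    {g : DetourIndex f j → Fin n → Fin n → ℝ}
    (hgu : ∀ i k t, (t ≠ f k ∨ k = j) → g i k t = detourEntry f j i k t) :
    LinearIndependent ℝ g := by
  classical
  rw [Fintype.linearIndependent_iff]
  intro c hc i
  suffices h : ∃ k t, (t ≠ f k ∨ k = j) ∧
      ∀ i', detourEntry f j i' k t = if i' = i then 1 else 0 by
    obtain ⟨k, t, hkt, h⟩ := h
    have h1 := congrFun (congrFun hc k) t
    simpa [Finset.sum_apply, hgu _ k t hkt, h] using h1
  rcases i with p | q
  · refine ⟨p.1.1, p.1.2, .inl p.2.2.1, ?_⟩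
    rintro (p' | q')
    · simp only [detourEntry, Sum.inl.injEq, Subtype.ext_iff, Prod.ext_iff]
      simp only [eq_comm]
    · simp [detourEntry, p.2.2.2.1, p.2.2.2.2]
  · refine ⟨j, q.2.1, .inr rfl, ?_⟩
    rintro (p' | q')
    · simp only [detourEntry, reduceCtorEq, if_false]
      exact if_neg fun h => p'.2.2.2.1 h.1.symm
    · have h1 : q'.1 = q.1 := by
        have h2 := Fin.lt_def.1 q'.1.2
        have h3 := Fin.lt_def.1 q.1.2
        exact Subtype.ext (Fin.ext (by omega))
      simp only [detourEntry, q.1.2.ne', false_and, if_false, true_and, zero_add,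
        Sum.inr.injEq, Prod.ext_iff, h1, Subtype.ext_iff]
      simp only [eq_comm]

theorem isSimplePolytope_of_pos {n : ℕ} (hn : 0 < n) {a : Fin n → ℕ} (ha : 0 < a ⟨0, hn⟩)
    (h : ∀ j : Fin n, 2 ≤ (j : ℕ) → (j : ℕ) + 1 < n → 0 < a j) :
    IsSimplePolytope (TeslerPolytope n a) := by
  intro v hv
  obtain ⟨f, hf, hoff, hidle⟩ := exists_support_of_mem_extremePoints hv
  have hrow : ∀ k, v k (f k) = 0 → ∀ t, v k t = 0 := by
    intro k hk t
    by_cases ht : t = f k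
    · rw [ht, hk]
    · exact hoff k t ht
  have hfne : ∀ k, v k (f k) = 0 → ∀ i, i < k → f i ≠ k := by
    intro k hk i hi hfi
    have h1 := (col_eq_zero hv.1 (hrow k hk)).2 i hi
    have h2 := hidle i (by rw [hfi, h1])
    exact hi.ne (h2.symm.trans hfi)
  have hval : ∀ k : Fin n, v k (f k) = 0 → (k : ℕ) = 1 ∨ (k : ℕ) + 1 = n := by
    intro k hk
    have h1 := (col_eq_zero hv.1 (hrow k hk)).1
    have h2 : (k : ℕ) ≠ 0 := by
      intro h0
      rw [show k = ⟨0, hn⟩ from Fin.ext h0] at h1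
      omega
    by_contra! hcon
    have := h k (by omega) (by omega)
    omega
  have hlast : ∀ k : Fin n, (k : ℕ) + 1 = n → ∀ d ∈ circulations n, (∀ i, i < k → 0 ≤ d i k) →
      0 ≤ d k k := by
    intro k hk d hd hpos
    rw [← sum_row_eq_single le_rfl fun t ht => hd.1 k t ?_, sum_row_eq_sum_col hd]
    · exact Finset.sum_nonneg fun i hi => hpos i (by simpa using hi)
    · exact lt_of_le_of_ne (Fin.le_def.2 (by omega)) ht
  by_cases hj : ∃ j : Fin n, (j : ℕ) = 1 ∧ v j (f j) = 0 ∧ 2 < n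
  · obtain ⟨j, hj1, hj0, hn2⟩ := hj
    obtain ⟨g, -, hgu, hiff⟩ := simple_at_iff_detours hv.1 hf (hidle j hj0) (hfne j hj0)
      (fun k t hkt => hkt.elim (hoff k t) fun hk => hrow k (hk ▸ hj0) t) (by
        intro d hd hpos k t hkt
        by_cases hc : t ≠ f k ∨ k = j
        · exact hpos k t hc
        · push Not at hc
          obtain ⟨rfl, hkj⟩ := hc
          rw [hidle k hkt]
          refine hlast k ((hval k hkt).resolve_left fun hk => hkj (Fin.ext (hk.trans hj1.symm)))
            d hd fun i hi => hpos i k (.inl (hfne k hkt i hi).symm))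
    exact hiff.2 (linearIndependent_detours hj1 hgu)
  · refine simple_at_of_orthant hv.1 hf hoff fun d hd hpos k t hkt => ?_
    by_cases hc : t = f k
    · subst hc
      have hk : (k : ℕ) + 1 = n := by
        rcases hval k hkt with h1 | h1
        · by_contra h2
          exact hj ⟨k, h1, hkt, by omega⟩
        · exact h1
      rw [hidle k hkt]
      exact hlast k hk d hd fun i hi => hpos i k (hfne k hkt i hi).symm
    · exact hpos k t hc

/-- Characterization of simplicity of the Tesler polytope (with `a₁ > 0`, and
`1`-based entries `a_1, …, a_n` written `0`-based): `Tes_n(a)` is simple iff `n ≤ 3`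
or the signature of `a` is `+^n`, `+^{n-1}0`, `+0+^{n-2}`, or `+0+^{n-3}0`. -/
theorem teslerPolytope_simple_iff (n : ℕ) (hn : 0 < n) (a : Fin n → ℕ)
    (ha : 0 < a ⟨0, hn⟩) :
    IsSimplePolytope (TeslerPolytope n a) ↔
      n ≤ 3 ∨
      (∀ i : Fin n, 0 < a i) ∨
      ((∀ i : Fin n, (i : ℕ) + 1 < n → 0 < a i) ∧
        (∀ i : Fin n, (i : ℕ) + 1 = n → a i = 0)) ∨
      ((∀ i : Fin n, (i : ℕ) ≠ 1 → 0 < a i) ∧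
        (∀ i : Fin n, (i : ℕ) = 1 → a i = 0)) ∨
      ((∀ i : Fin n, (i : ℕ) ≠ 1 → (i : ℕ) + 1 ≠ n → 0 < a i) ∧
        (∀ i : Fin n, (i : ℕ) = 1 ∨ (i : ℕ) + 1 = n → a i = 0)) := by
  have key : IsSimplePolytope (TeslerPolytope n a) ↔
      ∀ j : Fin n, 2 ≤ (j : ℕ) → (j : ℕ) + 1 < n → 0 < a j := by
    refine ⟨fun hs j hj hjn => ?_, isSimplePolytope_of_pos hn ha⟩
    by_contra h0
    exact not_isSimplePolytope_of_eq_zero hn ha hj hjn (Nat.eq_zero_of_not_pos h0) hs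
  rw [key]
  constructor
  · intro h
    by_cases hn3 : n ≤ 3
    · exact .inl hn3
    right
    have h0 : ∀ i : Fin n, (i : ℕ) ≠ 1 → (i : ℕ) + 1 ≠ n → 0 < a i := by
      intro i hi1 hin
      by_cases hi0 : (i : ℕ) = 0
      · rwa [show i = ⟨0, hn⟩ from Fin.ext hi0]
      · exact h i (by omega) (by omega)
    have e1 : ∀ i : Fin n, (i : ℕ) = 1 → a i = a ⟨1, by omega⟩ := fun i hi =>
      congrArg a (Fin.ext hi)
    have e2 : ∀ i : Fin n, (i : ℕ) + 1 = n → a i = a ⟨n - 1, by omega⟩ := fun i hi =>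
      congrArg a (Fin.ext (by simp; omega))
    rcases Nat.eq_zero_or_pos (a ⟨1, by omega⟩) with h1 | h1 <;>
      rcases Nat.eq_zero_or_pos (a ⟨n - 1, by omega⟩) with h2 | h2
    · refine .inr (.inr (.inr ⟨h0, ?_⟩))
      rintro i (hi | hi)
      · rw [e1 i hi, h1]
      · rw [e2 i hi, h2]
    · refine .inr (.inr (.inl ⟨fun i hi => ?_, fun i hi => by rw [e1 i hi, h1]⟩))
      by_cases hin : (i : ℕ) + 1 = n
      · rwa [e2 i hin]
      · exact h0 i hi hin
    · refine .inr (.inl ⟨fun i hi => ?_, fun i hi => by rw [e2 i hi, h2]⟩)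
      by_cases hi1 : (i : ℕ) = 1
      · rwa [e1 i hi1]
      · exact h0 i hi1 (by omega)
    · refine .inl fun i => ?_
      by_cases hi1 : (i : ℕ) = 1
      · rwa [e1 i hi1]
      by_cases hin : (i : ℕ) + 1 = n
      · rwa [e2 i hin]
      · exact h0 i hi1 hin
  · rintro (h | h | h | h | h) j hj hjn
    · omega
    · exact h j
    · exact h.1 j hjn
    · exact h.1 j (by omega)
    · exact h.1 j (by omega) (by omega)
end

section
/- Let a = (a_1,…,a_n) be a vector of positive integers. Then Σ_{i=0}^{C(n,2)} f_i (x−1)^i = ∏_{k=1}^n (1 + x + x^2 + ⋯ + x^{k−1}) as polynomials in ℤ[x], where f_i denotes the number of faces of the Tesler polytope Tes_n(a) of affine dimension i and C(n,2) = n(n−1)/2. In particular, the h-vector of the simple polytope Tes_n(a) is given by the Mahonian numbers: h_i is the number of permutations of {1,…,n} with i inversions. -/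
open Finset Polynomial

/-- The number of (nonempty, exposed) faces of affine dimension `i` of a polytope. -/
noncomputable def faceCount {E : Type*} [NormedAddCommGroup E] [NormedSpace ℝ E]
    (P : Set E) (i : ℕ) : ℕ :=
  ({F : Set E | F.Nonempty ∧ IsExposed ℝ P F ∧
      Module.finrank ℝ (affineSpan ℝ F).direction = i}).ncard

theorem sum_nonempty_subsets_pow {α : Type*} [DecidableEq α] (A : Finset α) :
    ∑ T ∈ A.powerset.filter (·.Nonempty), (X - 1 : ℤ[X]) ^ (#T - 1) =
      ∑ j ∈ range #A, X ^ j := by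
  have hX : (X - 1 : ℤ[X]) ≠ 0 := X_sub_C_ne_zero 1
  apply mul_right_cancel₀ hX
  rw [geom_sum_mul, Finset.sum_mul]
  have h := Finset.sum_pow_mul_eq_add_pow (X - 1 : ℤ[X]) 1 A
  simp only [one_pow, mul_one, sub_add_cancel] at h
  rw [← h, ← Finset.sum_filter_add_sum_filter_not A.powerset (·.Nonempty)]
  have h2 : A.powerset.filter (fun T => ¬ T.Nonempty) = {∅} := by
    ext T
    simp only [mem_filter, mem_powerset, not_nonempty_iff_eq_empty, mem_singleton]
    exact ⟨fun h => h.2, fun h => ⟨by simp [h], h⟩⟩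
  rw [h2]
  simp only [sum_singleton, card_empty, pow_zero, add_sub_cancel_right]
  refine Finset.sum_congr rfl fun T hT => ?_
  rw [← pow_succ, Nat.sub_add_cancel (mem_filter.1 hT).2.card_pos]

/-- Number of inversions of a permutation of `Fin n`. -/
def invCount {n : ℕ} (σ : Equiv.Perm (Fin n)) : ℕ :=
  (univ.filter (fun p : Fin n × Fin n => p.1 < p.2 ∧ σ p.2 < σ p.1)).card

/-- The permutation with `0 ↦ p` whose remaining values are in the relative order of `τ`. -/
def consPerm {n : ℕ} (x : Fin (n + 1) × Equiv.Perm (Fin n)) : Equiv.Perm (Fin (n + 1)) :=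
  x.1.cycleRange.symm * Equiv.Perm.decomposeFin.symm (0, x.2)

theorem consPerm_zero {n : ℕ} (x : Fin (n + 1) × Equiv.Perm (Fin n)) :
    consPerm x 0 = x.1 := by
  simp [consPerm]

theorem consPerm_succ {n : ℕ} (x : Fin (n + 1) × Equiv.Perm (Fin n)) (i : Fin n) :
    consPerm x i.succ = x.1.succAbove (x.2 i) := by
  simp [consPerm]

theorem consPerm_bijective (n : ℕ) : Function.Bijective (consPerm (n := n)) := by
  rw [Fintype.bijective_iff_injective_and_card]
  constructor
  · rintro ⟨p, τ⟩ ⟨q, υ⟩ h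
    have h0 : p = q := by simpa [consPerm_zero] using congrArg (· 0) h
    subst h0
    have : τ = υ := by
      ext i
      have := congrArg (· i.succ) h
      simp only [consPerm_succ] at this
      rw [Fin.succAbove_right_injective this]
    rw [this]
  · simp [Fintype.card_perm, Nat.factorial_succ]

theorem invCount_eq_sum {n : ℕ} (σ : Equiv.Perm (Fin n)) :
    invCount σ = ∑ i, ∑ j, if i < j ∧ σ j < σ i then 1 else 0 := by
  rw [invCount, Finset.card_filter, ← Finset.univ_product_univ, Finset.sum_product]

theorem invCount_consPerm {n : ℕ} (p : Fin (n + 1)) (τ : Equiv.Perm (Fin n)) :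
    invCount (consPerm (p, τ)) = p + invCount τ := by
  simp only [invCount_eq_sum, Fin.sum_univ_succ, consPerm_zero, consPerm_succ]
  have h : (∑ j : Fin n, if p.succAbove (τ j) < p then 1 else 0) = (p : ℕ) := by
    rw [Equiv.sum_comp τ (fun j => if p.succAbove j < p then 1 else 0)]
    have h_lt (j : Fin n) : p.succAbove j < p ↔ (j : ℕ) < p :=
      Fin.succAbove_lt_iff_castSucc_lt p j
    simp only [h_lt]
    rw [Fin.sum_univ_eq_sum_range (fun j => if j < (p : ℕ) then 1 else 0), ← Finset.card_filter]
    have : (range n).filter (· < (p : ℕ)) = range p := by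
      ext k
      have := p.is_lt
      simp
      omega
    rw [this, card_range]
  simp [h, Fin.succAbove_lt_succAbove_iff]

theorem sum_pow_invCount (n : ℕ) :
    ∑ σ : Equiv.Perm (Fin n), (X : ℤ[X]) ^ invCount σ =
      ∏ k ∈ range n, ∑ j ∈ range (k + 1), X ^ j := by
  induction n with
  | zero => simp [invCount]
  | succ n ih =>
    rw [prod_range_succ, ← ih, ← (Equiv.ofBijective _ (consPerm_bijective n)).sum_comp,
      Fintype.sum_prod_type_right, Finset.sum_mul]
    refine Finset.sum_congr rfl fun τ _ => ?_
    rw [← Fin.sum_univ_eq_sum_range (fun j => (X : ℤ[X]) ^ j), Finset.mul_sum]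
    refine Finset.sum_congr rfl fun p _ => ?_
    rw [Equiv.ofBijective_apply, invCount_consPerm, pow_add, mul_comm]

theorem coeff_prod_geom_sum (n i : ℕ) :
    (∏ k ∈ range n, ∑ j ∈ range (k + 1), (X : ℤ[X]) ^ j).coeff i =
      #{σ : Equiv.Perm (Fin n) | invCount σ = i} := by
  rw [← sum_pow_invCount, finsetSum_coeff]
  simp [coeff_X_pow, eq_comm]

/-- The linear map sending a matrix to its vector of hook sums. -/
noncomputable def hookMap (n : ℕ) : (Fin n → Fin n → ℝ) →ₗ[ℝ] (Fin n → ℝ) where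
  toFun x k := (∑ j ∈ univ.filter (fun j => k ≤ j), x k j)
    - (∑ i ∈ univ.filter (fun i => i < k), x i k)
  map_add' x y := by
    ext k
    simp only [Pi.add_apply, Finset.sum_add_distrib]
    ring
  map_smul' c x := by
    ext k
    simp only [Pi.smul_apply, smul_eq_mul, ← Finset.mul_sum, RingHom.id_apply]
    ring

/-- The families of row supports that occur for faces of the Tesler polytope. -/
def rowSupports (n : ℕ) : Finset (Fin n → Finset (Fin n)) :=
  Fintype.piFinset fun i => (Ici i).powerset.filter (·.Nonempty)

theorem mem_rowSupports {n : ℕ} {S : Fin n → Finset (Fin n)} :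
    S ∈ rowSupports n ↔ ∀ i, S i ⊆ Ici i ∧ (S i).Nonempty := by
  simp [rowSupports, Fintype.mem_piFinset]

/-- The points of the Tesler polytope whose `i`-th row is supported in `S i`. -/
def teslerFace {n : ℕ} (a : Fin n → ℕ) (S : Fin n → Finset (Fin n)) :
    Set (Fin n → Fin n → ℝ) :=
  {x | x ∈ TeslerPolytope n a ∧ ∀ i j, j ∉ S i → x i j = 0}

theorem mem_teslerPolytope_iff {n : ℕ} {a : Fin n → ℕ} {x : Fin n → Fin n → ℝ} :
    x ∈ TeslerPolytope n a ↔ (∀ i j, j < i → x i j = 0) ∧ (∀ i j, 0 ≤ x i j) ∧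
      hookMap n x = fun k => (a k : ℝ) := by
  simp only [TeslerPolytope, Set.mem_ofPred_eq, funext_iff, hookMap, LinearMap.coe_mk,
    AddHom.coe_mk]
  refine and_congr_right fun h => and_congr_left fun _ => ⟨fun h' i j => ?_, fun h' i j _ => h' i j⟩
  rcases lt_or_ge j i with hij | hij
  · exact (h i j hij).ge
  · exact h' i j hij

/-- Row sums of the matrix with hook sums `b` that is constant on the supports `S i`. -/
noncomputable def rowTotal {n : ℕ} (S : Fin n → Finset (Fin n)) (b : Fin n → ℝ) (k : Fin n) : ℝ :=
  b k + ∑ i : Fin n, if _h : i < k then (if k ∈ S i then rowTotal S b i / #(S i) else 0) else 0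
termination_by k

theorem exists_hookMap_eq {n : ℕ} {S : Fin n → Finset (Fin n)} (hS : S ∈ rowSupports n)
    (b : Fin n → ℝ) :
    ∃ v : Fin n → Fin n → ℝ, (∀ i j, j ∉ S i → v i j = 0) ∧ hookMap n v = b ∧
      ((∀ i, 0 < b i) → ∀ i, ∀ j ∈ S i, 0 < v i j) := by
  rw [mem_rowSupports] at hS
  have hcard (i : Fin n) : (0 : ℝ) < #(S i) := by exact_mod_cast (hS i).2.card_pos
  refine ⟨fun i j => if j ∈ S i then rowTotal S b i / #(S i) else 0, ?_, ?_, ?_⟩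
  · intro i j hij
    simp [hij]
  · ext k
    simp only [hookMap, LinearMap.coe_mk, AddHom.coe_mk]
    have h1 : ∑ j ∈ univ.filter (fun j => k ≤ j),
        (if j ∈ S k then rowTotal S b k / #(S k) else 0) = rowTotal S b k := by
      rw [← Finset.sum_filter, Finset.filter_filter]
      have : univ.filter (fun j => k ≤ j ∧ j ∈ S k) = S k := by
        ext j
        simpa using fun hj => Finset.mem_Ici.1 ((hS k).1 hj)
      rw [this, sum_const, nsmul_eq_mul, mul_div_cancel₀ _ (hcard k).ne']
    rw [h1, rowTotal, Finset.sum_filter]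
    simp
  · intro hb i j hij
    simp only [hij, if_true]
    refine div_pos ?_ (hcard i)
    clear hij j
    induction i using WellFoundedLT.induction with
    | _ i ih =>
      rw [rowTotal]
      refine add_pos_of_pos_of_nonneg (hb i) (Finset.sum_nonneg fun k _ => ?_)
      split_ifs with h1 h2
      · exact (div_pos (ih k h1) (hcard k)).le
      · exact le_rfl
      · exact le_rfl

theorem exists_pos_mem_teslerFace {n : ℕ} {a : Fin n → ℕ} (ha : ∀ i, 0 < a i)
    {S : Fin n → Finset (Fin n)} (hS : S ∈ rowSupports n) :
    ∃ x ∈ teslerFace a S, ∀ i, ∀ j ∈ S i, 0 < x i j := by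
  obtain ⟨v, hv0, hv, hpos⟩ := exists_hookMap_eq hS fun k => (a k : ℝ)
  have hpos' := hpos fun i => by exact_mod_cast ha i
  refine ⟨v, ⟨mem_teslerPolytope_iff.2 ⟨fun i j hij => hv0 i j fun hj => ?_, fun i j => ?_, hv⟩,
    hv0⟩, hpos'⟩
  · exact absurd (Finset.mem_Ici.1 ((mem_rowSupports.1 hS i).1 hj)) (not_le.2 hij)
  · by_cases hj : j ∈ S i
    · exact (hpos' i j hj).le
    · exact (hv0 i j hj).ge

theorem teslerFace_injOn {n : ℕ} {a : Fin n → ℕ} (ha : ∀ i, 0 < a i) :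
    Set.InjOn (teslerFace a) (rowSupports n : Set (Fin n → Finset (Fin n))) := by
  have key {S T : Fin n → Finset (Fin n)} (hS : S ∈ rowSupports n)
      (h : teslerFace a S = teslerFace a T) (i : Fin n) : S i ⊆ T i := by
    obtain ⟨x, hx, hpos⟩ := exists_pos_mem_teslerFace ha hS
    intro j hj
    by_contra hjT
    exact (hpos i j hj).ne' ((h ▸ hx).2 i j hjT)
  intro S hS T hT h
  ext1 i
  exact (key hS h i).antisymm (key hT h.symm i)

theorem isExposed_teslerFace {n : ℕ} (a : Fin n → ℕ) (S : Fin n → Finset (Fin n)) :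
    IsExposed ℝ (TeslerPolytope n a) (teslerFace a S) := by
  rintro ⟨x₀, hx₀⟩
  let l : (Fin n → Fin n → ℝ) →ₗ[ℝ] ℝ :=
    -∑ i, ∑ j ∈ univ.filter (· ∉ S i), LinearMap.proj j ∘ₗ LinearMap.proj i
  have hl (x : Fin n → Fin n → ℝ) : l x = -∑ i, ∑ j ∈ univ.filter (· ∉ S i), x i j := by
    simp [l]
  have hface {x : Fin n → Fin n → ℝ} (hx : x ∈ teslerFace a S) : l x = 0 := by
    rw [hl, neg_eq_zero]
    exact Finset.sum_eq_zero fun i _ => Finset.sum_eq_zero fun j hj =>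
      hx.2 i j (Finset.mem_filter.1 hj).2
  have hrow {x : Fin n → Fin n → ℝ} (hx : x ∈ TeslerPolytope n a) (i : Fin n) :
      0 ≤ ∑ j ∈ univ.filter (· ∉ S i), x i j :=
    Finset.sum_nonneg fun j _ => (mem_teslerPolytope_iff.1 hx).2.1 i j
  refine ⟨LinearMap.toContinuousLinearMap l, Set.ext fun x => ⟨fun hx => ⟨hx.1, fun y hy => ?_⟩,
    fun hx => ⟨hx.1, fun i j hj => ?_⟩⟩⟩
  · simp only [LinearMap.coe_toContinuousLinearMap', hface hx, hl]
    exact neg_nonpos.2 (Finset.sum_nonneg fun i _ => hrow hy i)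
  · have h := hx.2 x₀ hx₀.1
    simp only [LinearMap.coe_toContinuousLinearMap', hface hx₀, hl] at h
    have h0 := le_antisymm (neg_nonneg.1 h) (Finset.sum_nonneg fun i _ => hrow hx.1 i)
    have h1 := (Finset.sum_eq_zero_iff_of_nonneg fun i _ => hrow hx.1 i).1 h0 i (mem_univ i)
    exact (Finset.sum_eq_zero_iff_of_nonneg fun j _ =>
      (mem_teslerPolytope_iff.1 hx.1).2.1 i j).1 h1 j (by simp [hj])

open Filter Topology in
theorem exists_pos_forall_nonneg_add_mul {ι κ : Type*} [Finite ι] [Finite κ] {z d : ι → κ → ℝ}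
    (hz : ∀ i j, 0 ≤ z i j) (hd : ∀ i j, z i j = 0 → d i j = 0) :
    ∃ ε > (0 : ℝ), ∀ i j, 0 ≤ z i j + ε * d i j := by
  have h : ∀ᶠ ε in 𝓝[>] (0 : ℝ), ∀ i j, 0 ≤ z i j + ε * d i j := by
    refine eventually_all.2 fun i => eventually_all.2 fun j => ?_
    rcases (hz i j).eq_or_lt with h0 | h0
    · simp [hd i j h0.symm, ← h0]
    · have hc : Tendsto (fun ε : ℝ => z i j + ε * d i j) (𝓝 0) (𝓝 (z i j)) := by
        have : Continuous fun ε : ℝ => z i j + ε * d i j := by fun_prop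
        simpa using this.tendsto 0
      exact ((hc.mono_left nhdsWithin_le_nhds).eventually (lt_mem_nhds h0)).mono fun _ h => h.le
  obtain ⟨ε, hε, hpos⟩ := (h.and self_mem_nhdsWithin).exists
  exact ⟨ε, hpos, hε⟩

theorem convex_teslerPolytope {n : ℕ} (a : Fin n → ℕ) : Convex ℝ (TeslerPolytope n a) := by
  intro x hx y hy s t hs ht hst
  rw [mem_teslerPolytope_iff] at *
  refine ⟨fun i j hij => by simp [hx.1 i j hij, hy.1 i j hij], fun i j => ?_, ?_⟩
  · exact add_nonneg (mul_nonneg hs (hx.2.1 i j)) (mul_nonneg ht (hy.2.1 i j))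
  · rw [map_add, map_smul, map_smul, hx.2.2, hy.2.2, ← add_smul, hst, one_smul]

theorem Convex.exists_mem_forall_pos {ι κ : Type*} {F : Set (ι → κ → ℝ)} (hF : Convex ℝ F)
    (hne : F.Nonempty) (hnn : ∀ x ∈ F, ∀ i j, 0 ≤ x i j) (T : Finset (ι × κ)) :
    ∃ z ∈ F, ∀ p ∈ T, (∃ x ∈ F, x p.1 p.2 ≠ 0) → 0 < z p.1 p.2 := by
  classical
  induction T using Finset.induction_on with
  | empty => exact ⟨hne.some, hne.some_mem, by simp⟩
  | insert q T _ ih =>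
    obtain ⟨z, hz, hzT⟩ := ih
    by_cases hq : ∃ x ∈ F, x q.1 q.2 ≠ 0
    · obtain ⟨x, hx, hxq⟩ := hq
      refine ⟨(1 / 2 : ℝ) • z + (1 / 2 : ℝ) • x,
        hF hz hx (by norm_num) (by norm_num) (by norm_num), fun p hp hp' => ?_⟩
      simp only [Pi.add_apply, Pi.smul_apply, smul_eq_mul]
      have h1 := hnn z hz p.1 p.2
      have h2 := hnn x hx p.1 p.2
      rcases Finset.mem_insert.1 hp with rfl | hpT
      · have := lt_of_le_of_ne h2 hxq.symm
        linarith
      · have := hzT p hpT hp'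
        linarith
    · refine ⟨z, hz, fun p hp hp' => ?_⟩
      rcases Finset.mem_insert.1 hp with rfl | hpT
      · exact absurd hp' hq
      · exact hzT p hpT hp'

theorem exists_eq_teslerFace {n : ℕ} {a : Fin n → ℕ} (ha : ∀ i, 0 < a i)
    {F : Set (Fin n → Fin n → ℝ)} (hne : F.Nonempty) (hF : IsExposed ℝ (TeslerPolytope n a) F) :
    ∃ S ∈ rowSupports n, teslerFace a S = F := by
  classical
  have hsub : F ⊆ TeslerPolytope n a := hF.subset
  obtain ⟨z, hz, hzpos⟩ := (hF.convex (convex_teslerPolytope a)).exists_mem_forall_pos hne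
    (fun x hx => (mem_teslerPolytope_iff.1 (hsub hx)).2.1) univ
  have hzP := mem_teslerPolytope_iff.1 (hsub hz)
  have hsupp {x : Fin n → Fin n → ℝ} (hx : x ∈ F) {i j : Fin n} (h : z i j = 0) : x i j = 0 := by
    by_contra h'
    exact (hzpos (i, j) (mem_univ _) ⟨x, hx, h'⟩).ne' h
  refine ⟨fun i => univ.filter fun j => z i j ≠ 0, mem_rowSupports.2 fun i => ⟨fun j hj => ?_, ?_⟩,
    Set.Subset.antisymm (fun y hy => ?_) fun x hx =>
      ⟨hsub hx, fun i j hij => hsupp hx (by simpa using hij)⟩⟩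
  · by_contra hij
    exact (Finset.mem_filter.1 hj).2 (hzP.1 i j (by simpa using hij))
  · by_contra hempty
    have hzero (j : Fin n) : z i j = 0 := by
      by_contra h
      exact hempty ⟨j, by simp [h]⟩
    have h := congrFun hzP.2.2 i
    simp only [hookMap, LinearMap.coe_mk, AddHom.coe_mk, hzero, sum_const_zero, zero_sub] at h
    have h1 : 0 ≤ ∑ k ∈ univ.filter (fun k => k < i), z k i :=
      Finset.sum_nonneg fun k _ => hzP.2.1 k i
    have h2 : (0 : ℝ) < a i := by exact_mod_cast ha i
    linarith
  · have hyP := mem_teslerPolytope_iff.1 hy.1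
    have hy0 (i j : Fin n) (h : z i j = 0) : y i j = 0 := hy.2 i j (by simp [h])
    obtain ⟨ε, hε, hnn⟩ := exists_pos_forall_nonneg_add_mul (z := z) (d := z - y) hzP.2.1
      fun i j h => by simp [h, hy0 i j h]
    have hw : z + ε • (z - y) ∈ TeslerPolytope n a := by
      refine mem_teslerPolytope_iff.2 ⟨fun i j hij => ?_, fun i j => hnn i j, ?_⟩
      · simp [hzP.1 i j hij, hyP.1 i j hij]
      · rw [map_add, map_smul, map_sub, hzP.2.2, hyP.2.2, sub_self, smul_zero, add_zero]
    obtain ⟨l, rfl⟩ := hF hne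
    have h := hz.2 _ hw
    rw [map_add, map_smul, map_sub, smul_eq_mul] at h
    have hle : l z ≤ l y := by
      by_contra hlt
      have := mul_pos hε (sub_pos.2 (not_le.1 hlt))
      linarith
    exact ⟨hy.1, fun w hw => (hz.2 w hw).trans hle⟩

/-- Extension by zero of a function on the positions of a support family to a matrix. -/
noncomputable def extendSupport {n : ℕ} (S : Fin n → Finset (Fin n)) :
    ((Σ i, S i) → ℝ) →ₗ[ℝ] (Fin n → Fin n → ℝ) where
  toFun f i j := if h : j ∈ S i then f ⟨i, j, h⟩ else 0
  map_add' f g := by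
    ext i j
    by_cases h : j ∈ S i <;> simp [h]
  map_smul' c f := by
    ext i j
    by_cases h : j ∈ S i <;> simp [h]

theorem extendSupport_apply {n : ℕ} (S : Fin n → Finset (Fin n)) (f : (Σ i, S i) → ℝ)
    (i j : Fin n) : extendSupport S f i j = if h : j ∈ S i then f ⟨i, j, h⟩ else 0 :=
  rfl

theorem extendSupport_injective {n : ℕ} (S : Fin n → Finset (Fin n)) :
    Function.Injective (extendSupport S) := by
  intro f g h
  ext ⟨i, j, hj⟩
  have := congrFun (congrFun h i) j
  simpa [extendSupport_apply, hj] using this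

theorem exists_extendSupport_eq {n : ℕ} {S : Fin n → Finset (Fin n)} {v : Fin n → Fin n → ℝ}
    (hv : ∀ i j, j ∉ S i → v i j = 0) : ∃ f, extendSupport S f = v := by
  refine ⟨fun p => v p.1 p.2, ?_⟩
  ext i j
  by_cases h : j ∈ S i
  · simp [extendSupport_apply, h]
  · simp [extendSupport_apply, h, hv i j h]

theorem vectorSpan_teslerFace {n : ℕ} {a : Fin n → ℕ} (ha : ∀ i, 0 < a i)
    {S : Fin n → Finset (Fin n)} (hS : S ∈ rowSupports n) :
    vectorSpan ℝ (teslerFace a S) =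
      (LinearMap.ker (hookMap n ∘ₗ extendSupport S)).map (extendSupport S) := by
  apply le_antisymm
  · rw [vectorSpan_def, Submodule.span_le]
    rintro _ ⟨x, hx, y, hy, rfl⟩
    obtain ⟨f, hf⟩ := exists_extendSupport_eq (S := S) (v := x - y)
      fun i j hij => by simp [hx.2 i j hij, hy.2 i j hij]
    refine ⟨f, ?_, hf⟩
    simp [hf, (mem_teslerPolytope_iff.1 hx.1).2.2, (mem_teslerPolytope_iff.1 hy.1).2.2]
  · rintro _ ⟨f, hf, rfl⟩
    have hf' : hookMap n (extendSupport S f) = 0 := hf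
    obtain ⟨x, hx, hpos⟩ := exists_pos_mem_teslerFace ha hS
    have hxP := mem_teslerPolytope_iff.1 hx.1
    have hd (i j : Fin n) (h : j ∉ S i) : extendSupport S f i j = 0 := by
      simp [extendSupport_apply, h]
    obtain ⟨ε, hε, hnn⟩ := exists_pos_forall_nonneg_add_mul (d := extendSupport S f) hxP.2.1
      fun i j h => hd i j fun hj => (hpos i j hj).ne' h
    have hw : x + ε • extendSupport S f ∈ teslerFace a S := by
      refine ⟨mem_teslerPolytope_iff.2 ⟨fun i j hij => ?_, fun i j => hnn i j, ?_⟩,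
        fun i j hij => ?_⟩
      · have hj : j ∉ S i := fun hj =>
          absurd (Finset.mem_Ici.1 ((mem_rowSupports.1 hS i).1 hj)) (not_le.2 hij)
        simp [hxP.1 i j hij, hd i j hj]
      · rw [map_add, map_smul, hf', smul_zero, add_zero, hxP.2.2]
      · simp [hx.2 i j hij, hd i j hij]
    have h := vsub_mem_vectorSpan ℝ hw hx
    rw [vsub_eq_sub, add_sub_cancel_left] at h
    simpa [smul_smul, hε.ne'] using Submodule.smul_mem _ ε⁻¹ h

theorem finrank_direction_teslerFace {n : ℕ} {a : Fin n → ℕ} (ha : ∀ i, 0 < a i)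
    {S : Fin n → Finset (Fin n)} (hS : S ∈ rowSupports n) :
    Module.finrank ℝ (affineSpan ℝ (teslerFace a S)).direction = ∑ i, (#(S i) - 1) := by
  rw [direction_affineSpan, vectorSpan_teslerFace ha hS,
    ← (Submodule.equivMapOfInjective _ (extendSupport_injective S) _).finrank_eq]
  have hsurj : LinearMap.range (hookMap n ∘ₗ extendSupport S) = ⊤ := by
    refine LinearMap.range_eq_top.2 fun b => ?_
    obtain ⟨v, hv0, hv, -⟩ := exists_hookMap_eq hS b
    obtain ⟨f, rfl⟩ := exists_extendSupport_eq hv0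
    exact ⟨f, hv⟩
  have h := LinearMap.finrank_range_add_finrank_ker (hookMap n ∘ₗ extendSupport S)
  rw [hsurj, finrank_top, Module.finrank_fin_fun, Module.finrank_fintype_fun_eq_card,
    Fintype.card_sigma] at h
  simp only [Fintype.card_coe] at h
  have h2 : ∑ i, (#(S i) - 1) + n = ∑ i, #(S i) := by
    have h3 : ∑ i, (#(S i) - 1 + 1) = ∑ i, #(S i) := Finset.sum_congr rfl fun i _ =>
      Nat.sub_add_cancel (mem_rowSupports.1 hS i).2.card_pos
    simpa [Finset.sum_add_distrib] using h3
  omega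

theorem faceCount_teslerPolytope {n : ℕ} {a : Fin n → ℕ} (ha : ∀ i, 0 < a i) (d : ℕ) :
    faceCount (TeslerPolytope n a) d =
      #{S ∈ rowSupports n | ∑ i, (#(S i) - 1) = d} := by
  rw [faceCount, ← Set.ncard_coe_finset, ← Set.InjOn.ncard_image
    ((teslerFace_injOn ha).mono (coe_subset.2 (filter_subset _ _)))]
  congr 1
  ext F
  simp only [Set.mem_ofPred_eq, Set.mem_image, mem_coe, mem_filter]
  constructor
  · rintro ⟨hne, hexp, hdim⟩
    obtain ⟨S, hS, rfl⟩ := exists_eq_teslerFace ha hne hexp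
    exact ⟨S, ⟨hS, (finrank_direction_teslerFace ha hS).symm.trans hdim⟩, rfl⟩
  · rintro ⟨S, ⟨hS, hdim⟩, rfl⟩
    obtain ⟨x, hx, -⟩ := exists_pos_mem_teslerFace ha hS
    exact ⟨⟨x, hx⟩, isExposed_teslerFace a S, (finrank_direction_teslerFace ha hS).trans hdim⟩

theorem sum_card_sub_one_le {n : ℕ} {S : Fin n → Finset (Fin n)} (hS : S ∈ rowSupports n) :
    ∑ i, (#(S i) - 1) ≤ n.choose 2 := by
  rw [Nat.choose_two_right, ← Finset.sum_range_id, ← Finset.sum_range_reflect,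
    ← Fin.sum_univ_eq_sum_range (fun i => n - 1 - i)]
  refine Finset.sum_le_sum fun i _ => ?_
  have := Finset.card_le_card (mem_rowSupports.1 hS i).1
  rw [Fin.card_Ici] at this
  omega

theorem sum_faceCount_mul_pow {n : ℕ} {a : Fin n → ℕ} (ha : ∀ i, 0 < a i) :
    ∑ i ∈ range (n.choose 2 + 1),
        (faceCount (TeslerPolytope n a) i : ℤ[X]) * (X - 1) ^ i =
      ∏ k ∈ range n, ∑ j ∈ range (k + 1), (X : ℤ[X]) ^ j := by
  calc
    _ = ∑ S ∈ rowSupports n, (X - 1 : ℤ[X]) ^ ∑ i, (#(S i) - 1) := by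
      rw [← Finset.sum_fiberwise_of_maps_to (t := range (n.choose 2 + 1))
        (g := fun S : Fin n → Finset (Fin n) => ∑ i, (#(S i) - 1))
        fun S hS => mem_range.2 (Nat.lt_succ_of_le (sum_card_sub_one_le hS))]
      refine Finset.sum_congr rfl fun d _ => ?_
      rw [faceCount_teslerPolytope ha, Finset.sum_congr rfl fun S hS => by
        rw [(mem_filter.1 hS).2], sum_const, nsmul_eq_mul]
    _ = ∏ i : Fin n, ∑ T ∈ (Ici i).powerset.filter (·.Nonempty), (X - 1 : ℤ[X]) ^ (#T - 1) := by
      rw [Finset.prod_univ_sum]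
      exact Finset.sum_congr rfl fun S _ => (Finset.prod_pow_eq_pow_sum _ _ _).symm
    _ = _ := by
      simp only [sum_nonempty_subsets_pow, Fin.card_Ici]
      rw [Fin.prod_univ_eq_prod_range (fun i => ∑ j ∈ range (n - i), (X : ℤ[X]) ^ j),
        ← Finset.prod_range_reflect]
      refine Finset.prod_congr rfl fun k hk => ?_
      have := mem_range.1 hk
      rw [show n - (n - 1 - k) = k + 1 by omega]

/-- For a vector `a` of positive integers,
`∑_{i=0}^{C(n,2)} f_i (x-1)^i = [n]!_x = ∏_{k=1}^n (1 + x + ⋯ + x^{k-1})` in `ℤ[x]`,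
where `f_i` is the number of faces of `Tes_n(a)` of dimension `i`; in particular the
`h`-vector of the simple polytope `Tes_n(a)` is given by the Mahonian numbers:
`h_i` is the number of permutations of `{1, …, n}` with `i` inversions. -/
theorem teslerPolytope_f_polynomial (n : ℕ) (a : Fin n → ℕ) (ha : ∀ i, 0 < a i) :
    (∑ i ∈ Finset.range (n.choose 2 + 1),
        (faceCount (TeslerPolytope n a) i : Polynomial ℤ) * (X - 1) ^ i) =
      (∏ k ∈ Finset.range n, ∑ j ∈ Finset.range (k + 1), (X : Polynomial ℤ) ^ j) ∧
    ∀ i : ℕ,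
      (∏ k ∈ Finset.range n, ∑ j ∈ Finset.range (k + 1), (X : Polynomial ℤ) ^ j).coeff i =
        ((univ.filter (fun σ : Equiv.Perm (Fin n) =>
          (univ.filter (fun p : Fin n × Fin n => p.1 < p.2 ∧ σ p.2 < σ p.1)).card = i)).card
          : ℤ) := by
  exact ⟨sum_faceCount_mul_pow ha, coeff_prod_geom_sum n⟩
end

section
/- Let n ≥ 3 and let a = (a_1,…,a_n) be a vector of nonnegative integers with a_1 > 0, a_2 = 0, and a_i > 0 for all 3 ≤ i ≤ n−1 (a_n arbitrary nonnegative). Then the Tesler polytope Tes_n(a) has exactly 2·(n−1)! extreme points, and Σ_{i=0}^{C(n,2)} f_i (x−1)^i = (1 + x^{n−1}) · ∏_{k=1}^{n−1} (1 + x + ⋯ + x^{k−1}) as polynomials in ℤ[x], where f_i denotes the number of faces of Tes_n(a) of affine dimension i. -/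
open Finset Polynomial

section StandardForm

variable {ι κ F : Type*} [AddCommGroup F] [Module ℝ F]

/-- The matrices whose support lies in `s`. -/
def supportedIn (s : ι → Finset κ) : Submodule ℝ (ι → κ → ℝ) where
  carrier := {v | ∀ i, ∀ j ∉ s i, v i j = 0}
  add_mem' hv hw i j hj := by simp [hv i j hj, hw i j hj]
  zero_mem' _ _ _ := rfl
  smul_mem' c v hv i j hj := by simp [hv i j hj]

/-- The polyhedron `{x | 0 ≤ x, A x = b}`. -/
def standardPolyhedron (A : (ι → κ → ℝ) →ₗ[ℝ] F) (b : F) : Set (ι → κ → ℝ) :=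
  {x | 0 ≤ x ∧ A x = b}

/-- The points of the polyhedron whose support lies in `s`. -/
def supportFace (A : (ι → κ → ℝ) →ₗ[ℝ] F) (b : F) (s : ι → Finset κ) : Set (ι → κ → ℝ) :=
  {y | y ∈ standardPolyhedron A b ∧ y ∈ supportedIn s}

variable {A : (ι → κ → ℝ) →ₗ[ℝ] F} {b : F} {x y v : ι → κ → ℝ} {s : ι → Finset κ}


lemma mem_supportedIn : v ∈ supportedIn s ↔ ∀ i, ∀ j ∉ s i, v i j = 0 := Iff.rfl

lemma convex_standardPolyhedron : Convex ℝ (standardPolyhedron A b) := by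
  rintro x ⟨hx, hAx⟩ y ⟨hy, hAy⟩ p q hp hq hpq
  refine ⟨add_nonneg (smul_nonneg hp hx) (smul_nonneg hq hy), ?_⟩
  rw [map_add, map_smul, map_smul, hAx, hAy, ← add_smul, hpq, one_smul]

variable [Fintype κ]

/-- The support of a matrix, row by row. -/
noncomputable def rowSupport (x : ι → κ → ℝ) : ι → Finset κ :=
  fun i => univ.filter fun j => x i j ≠ 0

lemma mem_rowSupport {i : ι} {j : κ} : j ∈ rowSupport x i ↔ x i j ≠ 0 := by
  simp [rowSupport]

lemma mem_supportedIn_iff_rowSupport_le : v ∈ supportedIn s ↔ rowSupport v ≤ s := by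
  refine forall_congr' fun i => ⟨fun h j hj => ?_, fun h j hj => ?_⟩
  · by_contra hjs
    exact mem_rowSupport.1 hj (h j hjs)
  · by_contra hv
    exact hj (h (mem_rowSupport.2 hv))

lemma mem_supportedIn_rowSupport : x ∈ supportedIn (rowSupport x) :=
  mem_supportedIn_iff_rowSupport_le.2 le_rfl

lemma supportFace_rowSupport_inj (hx : x ∈ standardPolyhedron A b)
    (hy : y ∈ standardPolyhedron A b)
    (h : supportFace A b (rowSupport x) = supportFace A b (rowSupport y)) :
    rowSupport x = rowSupport y :=
  have hx' : x ∈ supportFace A b (rowSupport x) := ⟨hx, mem_supportedIn_rowSupport⟩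
  have hy' : y ∈ supportFace A b (rowSupport y) := ⟨hy, mem_supportedIn_rowSupport⟩
  le_antisymm (mem_supportedIn_iff_rowSupport_le.1 (h ▸ hx').2)
    (mem_supportedIn_iff_rowSupport_le.1 (h ▸ hy').2)

variable [Fintype ι]

lemma finrank_supportedIn (s : ι → Finset κ) :
    Module.finrank ℝ (supportedIn s) = ∑ i, (s i).card := by
  classical
  let e : supportedIn s ≃ₗ[ℝ] (∀ i, (s i → ℝ)) :=
    { toFun := fun v i j => v.1 i j
      map_add' := fun _ _ => rfl
      map_smul' := fun _ _ => rfl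
      invFun := fun u => ⟨fun i j => if h : j ∈ s i then u i ⟨j, h⟩ else 0,
        fun i j hj => by simp [hj]⟩
      left_inv := fun v => by
        ext i j
        by_cases h : j ∈ s i
        · simp [h]
        · simp [h, v.2 i j h]
      right_inv := fun u => by
        ext i j
        simp }
  rw [e.finrank_eq, Module.finrank_pi_fintype]
  simp

/-- A point of a polyhedron can be moved a little in any direction of the kernel supported
on the support of the point. -/
lemma exists_pos_add_smul_mem (hx : x ∈ standardPolyhedron A b) (hv : A v = 0)
    (hs : v ∈ supportedIn (rowSupport x)) :
    ∃ ε : ℝ, 0 < ε ∧ x + ε • v ∈ standardPolyhedron A b := by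
  have key : ∀ᶠ ε : ℝ in nhdsWithin 0 (Set.Ioi 0), ∀ i j, 0 ≤ x i j + ε * v i j := by
    refine Filter.eventually_all.2 fun i => Filter.eventually_all.2 fun j => ?_
    by_cases h : x i j = 0
    · have : v i j = 0 := hs i j (by simpa [mem_rowSupport] using h)
      simp [h, this]
    · have hpos : 0 < x i j := lt_of_le_of_ne (hx.1 i j) (Ne.symm h)
      have hc : Continuous fun ε : ℝ => x i j + ε * v i j := by fun_prop
      have h0 : ∀ᶠ ε : ℝ in nhds 0, 0 < x i j + ε * v i j :=
        hc.continuousAt.eventually_const_lt (by simpa using hpos)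
      exact nhdsWithin_le_nhds (h0.mono fun _ => le_of_lt)
  obtain ⟨ε, hε, hpos⟩ := (key.and self_mem_nhdsWithin).exists
  exact ⟨ε, hpos, fun i j => by simpa using hε i j, by simp [hv, hx.2]⟩

lemma isExposed_supportFace (hx : x ∈ supportFace A b s) :
    IsExposed ℝ (standardPolyhedron A b) (supportFace A b s) := by
  classical
  intro _
  let l : (ι → κ → ℝ) →L[ℝ] ℝ := -∑ i, ∑ j ∈ (s i)ᶜ,
    (ContinuousLinearMap.proj j).comp (ContinuousLinearMap.proj (R := ℝ) (φ := fun _ : ι => κ → ℝ) i)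
  have hl : ∀ y, l y = -∑ i, ∑ j ∈ (s i)ᶜ, y i j := fun y => by simp [l]
  have hzero : ∀ y ∈ supportedIn s, l y = 0 := fun y hy => by
    rw [hl, neg_eq_zero]
    exact sum_eq_zero fun i _ => sum_eq_zero fun j hj => hy i j (mem_compl.1 hj)
  have hnonneg : ∀ y ∈ standardPolyhedron A b, ∀ i, 0 ≤ ∑ j ∈ (s i)ᶜ, y i j :=
    fun y hy i => sum_nonneg fun j _ => hy.1 i j
  refine ⟨l, Set.ext fun y => ⟨fun hy => ⟨hy.1, fun z hz => ?_⟩, fun hy => ⟨hy.1, ?_⟩⟩⟩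
  · rw [hzero y hy.2, hl, neg_nonpos]
    exact sum_nonneg fun i _ => hnonneg z hz i
  · have h := hy.2 x hx.1
    rw [hzero x hx.2, hl, neg_nonneg] at h
    have h0 := le_antisymm h (sum_nonneg fun i _ => hnonneg y hy.1 i)
    intro i j hj
    have hi := (sum_eq_zero_iff_of_nonneg fun i _ => hnonneg y hy.1 i).1 h0 i (mem_univ i)
    exact (sum_eq_zero_iff_of_nonneg fun j _ => hy.1.1 i j).1 hi j (mem_compl.2 hj)

/-- Every nonempty exposed face is cut out by the support of one of its points. -/
lemma exists_eq_supportFace {G : Set (ι → κ → ℝ)} (hG : IsExposed ℝ (standardPolyhedron A b) G)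
    (hne : G.Nonempty) : ∃ x ∈ G, G = supportFace A b (rowSupport x) := by
  classical
  obtain ⟨l, hl⟩ := hG hne
  have hconv : Convex ℝ G := hG.convex convex_standardPolyhedron
  obtain ⟨x, hxG, hmax⟩ := (Set.toFinite (rowSupport '' G)).exists_maximalFor id _
    (hne.image rowSupport)
  obtain ⟨x, hxG, rfl⟩ := hxG
  refine ⟨x, hxG, Set.ext fun y => ⟨fun hy => ⟨hG.subset hy, ?_⟩, fun hy => ?_⟩⟩
  · have hx0 := (hG.subset hxG).1
    have hy0 := (hG.subset hy).1
    set z : ι → κ → ℝ := (1 / 2 : ℝ) • x + (1 / 2 : ℝ) • y with hz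
    have hzG : z ∈ G := hconv hxG hy (by norm_num) (by norm_num) (by norm_num)
    have hzij : ∀ i j, z i j = 1 / 2 * x i j + 1 / 2 * y i j := fun i j => rfl
    have hle : rowSupport x ≤ rowSupport z := fun i j hj => by
      have h1 := hx0 i j
      have h2 := hy0 i j
      rw [mem_rowSupport] at hj ⊢
      have h3 := lt_of_le_of_ne h1 (Ne.symm hj)
      simp only [Pi.zero_apply] at h1 h2 h3
      rw [hzij]
      linarith
    have hzx : rowSupport z ≤ rowSupport x := hmax ⟨z, hzG, rfl⟩ hle
    refine mem_supportedIn_iff_rowSupport_le.2 (le_trans (fun i j hj => ?_) hzx)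
    have h1 := hx0 i j
    have h2 := hy0 i j
    rw [mem_rowSupport] at hj ⊢
    have h3 := lt_of_le_of_ne h2 (Ne.symm hj)
    simp only [Pi.zero_apply] at h1 h2 h3
    rw [hzij]
    linarith
  · have hxP := hG.subset hxG
    obtain ⟨ε, hε, hmem⟩ := exists_pos_add_smul_mem (v := x - y) hxP
      (by rw [map_sub, hxP.2, hy.1.2, sub_self])
      (sub_mem mem_supportedIn_rowSupport hy.2)
    rw [hl] at hxG ⊢
    have h := hxG.2 _ hmem
    rw [map_add, map_smul, map_sub, smul_eq_mul] at h
    have hxy : l x ≤ l y := by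
      by_contra! hlt
      nlinarith [mul_pos hε (sub_pos.2 hlt)]
    exact ⟨hy.1, fun z hz => (hxG.2 z hz).trans hxy⟩

lemma direction_affineSpan_supportFace (hx : x ∈ standardPolyhedron A b) :
    (affineSpan ℝ (supportFace A b (rowSupport x))).direction =
      LinearMap.ker A ⊓ supportedIn (rowSupport x) := by
  rw [direction_affineSpan]
  apply le_antisymm
  · rw [vectorSpan_def, Submodule.span_le]
    rintro _ ⟨y, hy, z, hz, rfl⟩
    refine ⟨?_, sub_mem hy.2 hz.2⟩
    simp [hy.1.2, hz.1.2]
  · rintro v ⟨hv, hs⟩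
    obtain ⟨ε, hε, hmem⟩ := exists_pos_add_smul_mem hx hv hs
    have h : x + ε • v -ᵥ x ∈ vectorSpan ℝ (supportFace A b (rowSupport x)) :=
      vsub_mem_vectorSpan ℝ
        ⟨hmem, add_mem mem_supportedIn_rowSupport (Submodule.smul_mem _ _ hs)⟩
        ⟨hx, mem_supportedIn_rowSupport⟩
    rw [vsub_eq_sub, add_sub_cancel_left] at h
    exact (Submodule.smul_mem_iff _ hε.ne').1 h

lemma faceCount_standardPolyhedron (i : ℕ) :
    faceCount (standardPolyhedron A b) i =
      {s | s ∈ rowSupport '' standardPolyhedron A b ∧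
        Module.finrank ℝ ↥(LinearMap.ker A ⊓ supportedIn s) = i}.ncard := by
  symm
  refine Set.ncard_congr (fun s _ => supportFace A b s) ?_ ?_ ?_
  · rintro _ ⟨⟨x, hx, rfl⟩, hi⟩
    have hx' : x ∈ supportFace A b (rowSupport x) := ⟨hx, mem_supportedIn_rowSupport⟩
    exact ⟨⟨x, hx'⟩, isExposed_supportFace hx', by rwa [direction_affineSpan_supportFace hx]⟩
  · rintro _ _ ⟨⟨x, hx, rfl⟩, -⟩ ⟨⟨y, hy, rfl⟩, -⟩ h
    exact supportFace_rowSupport_inj hx hy h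
  · rintro G ⟨hne, hG, hi⟩
    obtain ⟨x, hxG, rfl⟩ := exists_eq_supportFace hG hne
    refine ⟨rowSupport x, ⟨⟨x, hxG.1, rfl⟩, ?_⟩, rfl⟩
    rwa [direction_affineSpan_supportFace hxG.1] at hi

lemma isExposed_singleton_of_mem_extremePoints
    (hx : x ∈ (standardPolyhedron A b).extremePoints ℝ) :
    IsExposed ℝ (standardPolyhedron A b) {x} := by
  have hx' : x ∈ supportFace A b (rowSupport x) := ⟨hx.1, mem_supportedIn_rowSupport⟩
  have hface : supportFace A b (rowSupport x) = {x} := by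
    refine Set.eq_singleton_iff_unique_mem.2 ⟨hx', fun y hy => ?_⟩
    obtain ⟨ε, hε, hmem⟩ := exists_pos_add_smul_mem (v := x - y) hx.1
      (by rw [map_sub, hx.1.2, hy.1.2, sub_self])
      (sub_mem mem_supportedIn_rowSupport hy.2)
    refine hx.2 hy.1 hmem ⟨ε / (1 + ε), 1 / (1 + ε), by positivity, by positivity,
      by field_simp; ring, ?_⟩
    ext i j
    simp only [Pi.add_apply, Pi.smul_apply, Pi.sub_apply, smul_eq_mul]
    field_simp
    ring
  exact hface ▸ isExposed_supportFace hx'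

lemma ncard_extremePoints_standardPolyhedron :
    ((standardPolyhedron A b).extremePoints ℝ).ncard = faceCount (standardPolyhedron A b) 0 := by
  rw [faceCount, ← Set.ncard_image_of_injective _ Set.singleton_injective]
  congr 1
  ext G
  constructor
  · rintro ⟨x, hx, rfl⟩
    refine ⟨Set.singleton_nonempty x, isExposed_singleton_of_mem_extremePoints hx, ?_⟩
    simp [direction_affineSpan]
  · rintro ⟨⟨x, hx⟩, hG, h0⟩
    rw [direction_affineSpan, Submodule.finrank_eq_zero, vectorSpan_eq_bot_iff_subsingleton] at h0
    obtain rfl := h0.eq_singleton_of_mem hx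
    exact ⟨x, isExtreme_singleton.1 hG.isExtreme, rfl⟩

end StandardForm

section PowersetSums

variable {α R : Type*} [DecidableEq α] [CommRing R]

lemma sum_powerset_filter_mem_pow_card_sub_one (t : R) {A : Finset α} {c : α} (hc : c ∈ A) :
    ∑ B ∈ A.powerset.filter (c ∈ ·), t ^ (B.card - 1) = (t + 1) ^ (A.card - 1) := by
  have himage : A.powerset.filter (c ∈ ·) = (A.erase c).powerset.image (insert c) := by
    ext B
    simp only [mem_filter, mem_powerset, mem_image]
    constructor
    · rintro ⟨hB, hcB⟩
      exact ⟨B.erase c, erase_subset_erase c hB, insert_erase hcB⟩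
    · rintro ⟨C, hC, rfl⟩
      exact ⟨insert_subset hc (hC.trans (erase_subset c A)), mem_insert_self c C⟩
  have hnot : ∀ C ∈ (A.erase c).powerset, c ∉ C := fun C hC h =>
    notMem_erase c A (mem_powerset.1 hC h)
  rw [himage, sum_image fun C hC D hD h => by
    rw [← erase_insert (hnot C hC), ← erase_insert (hnot D hD)]
    exact congrArg (fun B => B.erase c) h]
  rw [← card_erase_of_mem hc, ← sum_pow_mul_eq_add_pow]
  refine sum_congr rfl fun C hC => ?_
  rw [card_insert_of_notMem (hnot C hC), Nat.add_sub_cancel, one_pow, mul_one]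

lemma sum_powerset_filter_nonempty_pow_card_sub_one (t : R) (A : Finset α) :
    ∑ B ∈ A.powerset.filter (·.Nonempty), t ^ (B.card - 1) =
      ∑ j ∈ range A.card, (t + 1) ^ j := by
  induction A using Finset.induction_on with
  | empty => simp [filter_singleton]
  | insert c A hc ih =>
    have h1 : ((insert c A).powerset.filter (·.Nonempty)).filter (c ∈ ·) =
        (insert c A).powerset.filter (c ∈ ·) := by
      rw [filter_filter]
      exact filter_congr fun B _ => ⟨fun h => h.2, fun h => ⟨⟨c, h⟩, h⟩⟩
    have h2 : ((insert c A).powerset.filter (·.Nonempty)).filter (c ∉ ·) =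
        A.powerset.filter (·.Nonempty) := by
      ext B
      simp only [mem_filter, mem_powerset]
      constructor
      · rintro ⟨⟨hB, hne⟩, hcB⟩
        exact ⟨(subset_insert_iff_of_notMem hcB).1 hB, hne⟩
      · rintro ⟨hB, hne⟩
        exact ⟨⟨hB.trans (subset_insert c A), hne⟩, fun h => hc (hB h)⟩
    rw [← sum_filter_add_sum_filter_not _ (c ∈ ·), h1, h2, ih,
      sum_powerset_filter_mem_pow_card_sub_one t (mem_insert_self c A),
      card_insert_of_notMem hc, Nat.add_sub_cancel, sum_range_succ, add_comm]

end PowersetSums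

namespace TeslerPolytope

variable {n : ℕ} {a : Fin n → ℕ} {s : Fin n → Finset (Fin n)} {x : Fin n → Fin n → ℝ}

/-- The entries below the diagonal, and the hook sums. -/
def constraints (n : ℕ) :
    (Fin n → Fin n → ℝ) →ₗ[ℝ] (Fin n → Fin n → ℝ) × (Fin n → ℝ) where
  toFun x := (fun i j => if j < i then x i j else 0,
    fun k => (∑ j ∈ univ.filter (fun j => k ≤ j), x k j)
      - ∑ i ∈ univ.filter (fun i => i < k), x i k)
  map_add' x y := by
    ext
    · simp only [Pi.add_apply, Prod.fst_add]
      split_ifs <;> simp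
    · simp only [Pi.add_apply, Prod.snd_add, sum_add_distrib]
      ring
  map_smul' c x := by
    ext
    · simp
    · simp [← mul_sum, mul_sub]

lemma constraints_eq_iff {c : Fin n → ℝ} :
    constraints n x = (0, c) ↔ (∀ i j : Fin n, j < i → x i j = 0) ∧
      ∀ k : Fin n, (∑ j ∈ univ.filter (fun j => k ≤ j), x k j)
        - (∑ i ∈ univ.filter (fun i => i < k), x i k) = c k := by
  simp [constraints, funext_iff]

lemma eq_standardPolyhedron (a : Fin n → ℕ) :
    TeslerPolytope n a = standardPolyhedron (constraints n) (0, fun k => (a k : ℝ)) := by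
  ext x
  simp only [TeslerPolytope, standardPolyhedron, Set.mem_ofPred_eq, constraints_eq_iff]
  constructor
  · rintro ⟨h1, h2, h3⟩
    refine ⟨fun i j => ?_, h1, h3⟩
    rcases lt_or_ge j i with h | h
    · simp [h1 i j h]
    · exact h2 i j h
  · rintro ⟨h1, h2, h3⟩
    exact ⟨h2, fun i j _ => h1 i j, h3⟩

/-- The row supports that occur in `Tes_n(a)`: row `k` is nonempty exactly if `a k > 0` or some
earlier row meets column `k`. -/
def IsValidSupport (a : Fin n → ℕ) (s : Fin n → Finset (Fin n)) : Prop :=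
  (∀ k, s k ⊆ Ici k) ∧ ∀ k, (s k).Nonempty ↔ 0 < a k ∨ ∃ i < k, k ∈ s i

lemma isValidSupport_rowSupport (hx : x ∈ TeslerPolytope n a) :
    IsValidSupport a (rowSupport x) := by
  have hx' := hx
  rw [eq_standardPolyhedron] at hx'
  have h0 : ∀ i j, 0 ≤ x i j := hx'.1
  obtain ⟨hlow, -, hhook⟩ := hx
  have hrow : ∀ k, 0 ≤ ∑ j ∈ univ.filter (fun j => k ≤ j), x k j :=
    fun k => sum_nonneg fun j _ => h0 k j
  have hcol : ∀ k, 0 ≤ ∑ i ∈ univ.filter (fun i => i < k), x i k :=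
    fun k => sum_nonneg fun i _ => h0 i k
  refine ⟨fun k j hj => ?_, fun k => ⟨fun ⟨j, hj⟩ => ?_, fun h => ?_⟩⟩
  · rw [mem_Ici]
    by_contra! h
    exact mem_rowSupport.1 hj (hlow k j h)
  · by_contra! h
    obtain ⟨hak, hin⟩ := h
    have hz : ∑ i ∈ univ.filter (fun i => i < k), x i k = 0 :=
      sum_eq_zero fun i hi => by simpa [mem_rowSupport] using hin i (mem_filter.1 hi).2
    have hk := hhook k
    rw [hz, Nat.le_zero.1 hak, Nat.cast_zero, sub_zero,
      sum_eq_zero_iff_of_nonneg fun j _ => h0 k j] at hk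
    refine mem_rowSupport.1 hj (hk j (mem_filter.2 ⟨mem_univ _, ?_⟩))
    by_contra! hjk
    exact mem_rowSupport.1 hj (hlow k j hjk)
  · by_contra hne
    have hz : ∑ j ∈ univ.filter (fun j => k ≤ j), x k j = 0 := sum_eq_zero fun j _ => by
      by_contra hj
      exact hne ⟨j, mem_rowSupport.2 hj⟩
    have hk := hhook k
    have hck := hcol k
    have hak : (0 : ℝ) ≤ a k := Nat.cast_nonneg _
    rcases h with h | ⟨i, hik, hi⟩
    · have : (0 : ℝ) < a k := Nat.cast_pos.2 h
      linarith
    · have hzc : ∑ i ∈ univ.filter (fun i => i < k), x i k = 0 := by linarith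
      rw [sum_eq_zero_iff_of_nonneg fun i _ => h0 i k] at hzc
      exact mem_rowSupport.1 hi (hzc i (mem_filter.2 ⟨mem_univ _, hik⟩))

/-- A triangular affine recursion has a solution. -/
lemma exists_recursion_solution (w : Fin n → Fin n → ℝ) (c : Fin n → ℝ) :
    ∃ r : Fin n → ℝ, ∀ k, r k = c k + ∑ i ∈ univ.filter (fun i => i < k), w i k * r i := by
  let f : ∀ k : Fin n, (∀ i : Fin n, i < k → ℝ) → ℝ := fun k r =>
    c k + ∑ i ∈ (univ.filter (fun i => i < k)).attach, w i k * r i (mem_filter.1 i.2).2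
  refine ⟨(wellFounded_lt (α := Fin n)).fix f, fun k => ?_⟩
  rw [WellFounded.fix_eq]
  simp only [f]
  rw [sum_attach _ fun i => w i k * (wellFounded_lt (α := Fin n)).fix f i]

/-- The flow through the rows when row `i` distributes its total `r i` with weights `w i`. -/
lemma exists_constraints_eq (hs : IsValidSupport a s) {w : Fin n → Fin n → ℝ}
    (hw : w ∈ supportedIn s) (hsum : ∀ k, (s k).Nonempty → ∑ j, w k j = 1) {c : Fin n → ℝ}
    (hc : ∀ k, s k = ∅ → c k = 0) :
    ∃ r : Fin n → ℝ, (∀ k, r k = c k + ∑ i ∈ univ.filter (fun i => i < k), w i k * r i) ∧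
      constraints n (fun i j => w i j * r i) = (0, c) := by
  obtain ⟨r, hr⟩ := exists_recursion_solution w c
  have hlow : ∀ i j : Fin n, j < i → w i j = 0 := fun i j hji =>
    hw i j fun hj => absurd (mem_Ici.1 (hs.1 i hj)) (not_le.2 hji)
  refine ⟨r, hr, constraints_eq_iff.2 ⟨fun i j hji => by simp [hlow i j hji], fun k => ?_⟩⟩
  have hrow : ∑ j ∈ univ.filter (fun j => k ≤ j), w k j * r k = (∑ j, w k j) * r k := by
    rw [sum_mul]
    refine sum_filter_of_ne fun j _ hj => ?_
    by_contra! hjk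
    exact hj (by simp [hlow k j hjk])
  rw [hrow]
  rcases (s k).eq_empty_or_nonempty with hk | hk
  · have hin : ∑ i ∈ univ.filter (fun i => i < k), w i k * r i = 0 := by
      refine sum_eq_zero fun i hi => ?_
      rw [hw i k fun hki => ?_, zero_mul]
      exact (hk ▸ (hs.2 k).2 (Or.inr ⟨i, (mem_filter.1 hi).2, hki⟩)).ne_empty rfl
    have hzero : ∑ j, w k j = 0 := sum_eq_zero fun j _ => hw k j (by simp [hk])
    rw [hin, hzero, hc k hk]
    simp
  · rw [hsum k hk]
    linarith [hr k]

lemma exists_mem_rowSupport_eq (hs : IsValidSupport a s) :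
    ∃ x ∈ TeslerPolytope n a, rowSupport x = s := by
  let w : Fin n → Fin n → ℝ := fun i j => if j ∈ s i then ((s i).card : ℝ)⁻¹ else 0
  have hw0 : ∀ i j, 0 ≤ w i j := fun i j => by
    simp only [w]
    split_ifs <;> positivity
  have hwpos : ∀ i, ∀ j ∈ s i, 0 < w i j := fun i j hj => by
    have : 0 < (s i).card := card_pos.2 ⟨j, hj⟩
    simp only [w, if_pos hj]
    positivity
  obtain ⟨r, hr, hx⟩ := exists_constraints_eq (w := w) (c := fun k => (a k : ℝ)) hs
    (fun i j hj => by simp [w, hj])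
    (fun k hk => by
      have : ((s k).card : ℝ) ≠ 0 := by exact_mod_cast hk.card_pos.ne'
      simp only [w]
      rw [sum_ite_mem, univ_inter, sum_const, nsmul_eq_mul, mul_inv_cancel₀ this])
    (fun k hk => by
      have := (hs.2 k).not.1 (by simp [hk])
      push Not at this
      exact_mod_cast Nat.le_zero.1 this.1)
  have hrpos : ∀ k, 0 ≤ r k ∧ ((s k).Nonempty → 0 < r k) := fun k => by
    induction k using WellFoundedLT.induction with
    | ind k ih =>
      have hnonneg : ∀ i ∈ univ.filter (fun i => i < k), 0 ≤ w i k * r i :=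
        fun i hi => mul_nonneg (hw0 i k) (ih i (mem_filter.1 hi).2).1
      have hsum := sum_nonneg hnonneg
      have hak : (0 : ℝ) ≤ a k := Nat.cast_nonneg _
      rw [hr k]
      refine ⟨add_nonneg hak hsum, fun hk => ?_⟩
      rcases (hs.2 k).1 hk with h | ⟨i, hik, hi⟩
      · have : (0 : ℝ) < a k := Nat.cast_pos.2 h
        linarith
      · have hle := single_le_sum hnonneg (mem_filter.2 ⟨mem_univ i, hik⟩)
        have := mul_pos (hwpos i k hi) ((ih i hik).2 ⟨k, hi⟩)
        linarith
  refine ⟨fun i j => w i j * r i, ?_, ?_⟩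
  · rw [eq_standardPolyhedron]
    exact ⟨fun i j => mul_nonneg (hw0 i j) (hrpos i).1, hx⟩
  · ext i j
    rw [mem_rowSupport]
    refine ⟨fun h => ?_, fun h => (mul_pos (hwpos i j h) ((hrpos i).2 ⟨j, h⟩)).ne'⟩
    by_contra hj
    exact h (by simp [w, hj])

lemma image_rowSupport : rowSupport '' TeslerPolytope n a = {s | IsValidSupport a s} := by
  ext s
  constructor
  · rintro ⟨x, hx, rfl⟩
    exact isValidSupport_rowSupport hx
  · exact exists_mem_rowSupport_eq

/-- The dimension of the face with row supports `s`. -/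
def faceDim (s : Fin n → Finset (Fin n)) : ℕ := ∑ k, ((s k).card - 1)

lemma finrank_ker_inf_supportedIn (hs : IsValidSupport a s) :
    Module.finrank ℝ ↥(LinearMap.ker (constraints n) ⊓ supportedIn s) = faceDim s := by
  classical
  let L : supportedIn s →ₗ[ℝ] ({k // (s k).Nonempty} → ℝ) :=
    (LinearMap.funLeft ℝ ℝ Subtype.val).comp
      ((LinearMap.snd ℝ _ _).comp ((constraints n).comp (supportedIn s).subtype))
  have hL : ∀ v k, L v k = (constraints n v.1).2 k := fun v k => rfl
  have hempty : ∀ v ∈ supportedIn s, ∀ k, s k = ∅ → (constraints n v).2 k = 0 := by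
    intro v hv k hk
    have h1 : ∀ j, v k j = 0 := fun j => hv k j (by simp [hk])
    have h2 : ∀ i < k, v i k = 0 := fun i hi => hv i k fun hki =>
      ((hs.2 k).2 (Or.inr ⟨i, hi, hki⟩)).ne_empty hk
    simp only [constraints, LinearMap.coe_mk, AddHom.coe_mk]
    rw [sum_eq_zero fun j _ => h1 j, sum_eq_zero fun i hi => h2 i (mem_filter.1 hi).2, sub_zero]
  have hlow : ∀ v ∈ supportedIn s, (constraints n v).1 = 0 := by
    intro v hv
    ext i j
    simp only [constraints, LinearMap.coe_mk, AddHom.coe_mk, Pi.zero_apply, ite_eq_right_iff]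
    exact fun hji => hv i j fun hj => absurd (mem_Ici.1 (hs.1 i hj)) (not_le.2 hji)
  have hker : (LinearMap.ker L).map (supportedIn s).subtype =
      LinearMap.ker (constraints n) ⊓ supportedIn s := by
    ext v
    constructor
    · rintro ⟨v, hv, rfl⟩
      refine ⟨Prod.ext (hlow v v.2) (funext fun k => ?_), v.2⟩
      rcases (s k).eq_empty_or_nonempty with hk | hk
      · exact hempty v v.2 k hk
      · exact (hL v ⟨k, hk⟩).symm.trans (congrFun (LinearMap.mem_ker.1 hv) ⟨k, hk⟩)
    · rintro ⟨hv, hvs⟩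
      refine ⟨⟨v, hvs⟩, LinearMap.mem_ker.2 (funext fun k => ?_), rfl⟩
      rw [hL, LinearMap.mem_ker.1 hv]
      rfl
  have hsurj : Function.Surjective L := by
    intro u
    let w : Fin n → Fin n → ℝ := fun i j =>
      if h : (s i).Nonempty then (if j = h.choose then 1 else 0) else 0
    have hw : w ∈ supportedIn s := fun i j hj => by
      simp only [w]
      split_ifs with h1 h2
      · exact absurd (h2 ▸ h1.choose_spec) hj
      · rfl
      · rfl
    obtain ⟨r, -, hx⟩ := exists_constraints_eq (w := w) hs hw
      (c := fun k => if h : (s k).Nonempty then u ⟨k, h⟩ else 0)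
      (fun k hk => by simp [w, hk]) (fun k hk => by simp [hk])
    refine ⟨⟨fun i j => w i j * r i, fun i j hj => by simp [hw i j hj]⟩,
      funext fun k => ?_⟩
    rw [hL, hx]
    simp [k.2]
  have hrank := L.finrank_range_add_finrank_ker
  rw [LinearMap.range_eq_top.2 hsurj, finrank_top, Module.finrank_fintype_fun_eq_card,
    finrank_supportedIn, Fintype.card_subtype] at hrank
  rw [← hker, Submodule.finrank_map_subtype_eq, faceDim]
  have hsplit : ∑ k, (s k).card =
      ∑ k, ((s k).card - 1) + (univ.filter fun k => (s k).Nonempty).card := by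
    rw [card_filter, ← sum_add_distrib]
    refine sum_congr rfl fun k _ => ?_
    split_ifs with h
    · exact (Nat.sub_add_cancel h.card_pos).symm
    · simp [not_nonempty_iff_eq_empty.1 h]
  omega

lemma faceDim_le (hs : IsValidSupport a s) : faceDim s ≤ n.choose 2 := by
  calc faceDim s ≤ ∑ k : Fin n, (n - 1 - k) := sum_le_sum fun k _ => by
        have := card_le_card (hs.1 k)
        rw [Fin.card_Ici] at this
        omega
    _ = n.choose 2 := by
        rw [Fin.sum_univ_eq_sum_range (fun k => n - 1 - k) n, sum_range_reflect (fun k => k) n,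
          sum_range_id, Nat.choose_two_right]

open Classical in
lemma faceCount_eq (i : ℕ) : faceCount (TeslerPolytope n a) i =
    (univ.filter fun s => IsValidSupport a s ∧ faceDim s = i).card := by
  rw [eq_standardPolyhedron, faceCount_standardPolyhedron, ← eq_standardPolyhedron,
    image_rowSupport, ← Set.ncard_coe_finset]
  congr 1
  ext s
  simp only [Set.mem_ofPred_eq, coe_filter, mem_univ, true_and]
  exact and_congr_right fun hs => by rw [finrank_ker_inf_supportedIn hs]

open Classical in
/-- The face polynomial as a sum over row supports. -/
lemma sum_faceCount_mul_pow {R : Type*} [CommRing R] (t : R) :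
    ∑ i ∈ range (n.choose 2 + 1), (faceCount (TeslerPolytope n a) i : R) * t ^ i =
      ∑ s ∈ univ.filter (IsValidSupport a), ∏ k, t ^ ((s k).card - 1) := by
  rw [← sum_fiberwise_of_maps_to (s := univ.filter (IsValidSupport a)) (g := faceDim)
    (t := range (n.choose 2 + 1))
    fun s hs => mem_range.2 (Nat.lt_succ_of_le (faceDim_le (mem_filter.1 hs).2))]
  refine sum_congr rfl fun i _ => ?_
  rw [filter_filter, faceCount_eq, ← nsmul_eq_mul, ← sum_const]
  refine sum_congr rfl fun s hs => ?_
  rw [prod_pow_eq_pow_sum, ← (mem_filter.1 hs).2.2, faceDim]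

section Signature

variable {p : ℕ} {a : Fin (p + 3) → ℕ} {s : Fin (p + 3) → Finset (Fin (p + 3))}

lemma row_condition_iff (ha0 : 0 < a 0) (ha1 : a 1 = 0)
    (ha : ∀ i : Fin (p + 3), 2 ≤ (i : ℕ) → i ≠ Fin.last (p + 2) → 0 < a i)
    {k : Fin (p + 3)} (hk : k ≠ Fin.last (p + 2)) :
    (0 < a k ∨ ∃ i < k, k ∈ s i) ↔ (k = 1 → 1 ∈ s 0) := by
  by_cases h1 : k = 1
  · subst h1
    simp [ha1, Fin.lt_one_iff]
  · have hpos : 0 < a k := by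
      by_cases h0 : k = 0
      · exact h0 ▸ ha0
      · refine ha k ?_ hk
        simp only [Fin.ext_iff, Fin.val_zero, Fin.val_one] at h0 h1
        omega
    simp [h1, hpos]

open Classical in
/-- The last row contributes a trivial factor, so it may be assumed to be nonempty. -/
lemma sum_isValidSupport_eq_sum_nonempty_last {R : Type*} [CommRing R] (t : R)
    (ha0 : 0 < a 0) (ha1 : a 1 = 0)
    (ha : ∀ i : Fin (p + 3), 2 ≤ (i : ℕ) → i ≠ Fin.last (p + 2) → 0 < a i) :
    ∑ s ∈ univ.filter (IsValidSupport a), ∏ k, t ^ ((s k).card - 1) =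
      ∑ s ∈ univ.filter (fun s : Fin (p + 3) → Finset (Fin (p + 3)) =>
        ∀ k, s k ⊆ Ici k ∧ ((s k).Nonempty ↔ (k = 1 → 1 ∈ s 0))),
        ∏ k, t ^ ((s k).card - 1) := by
  set l := Fin.last (p + 2) with hl
  have h0l : (0 : Fin (p + 3)) ≠ l := (Fin.last_pos).ne
  have h1l : l ≠ 1 := by simp [hl, Fin.ext_iff]
  have hIci : Ici l = {l} := by
    ext j
    simp [hl, Fin.last_le_iff]
  refine sum_nbij (fun s => Function.update s l {l}) ?_ ?_ ?_ ?_
  · intro s hs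
    have hs := (mem_filter.1 hs).2
    refine mem_filter.2 ⟨mem_univ _, fun k => ?_⟩
    by_cases hk : k = l
    · subst hk
      simp [h1l]
    · simp only [Function.update_of_ne hk, Function.update_of_ne h0l]
      exact ⟨hs.1 k, (hs.2 k).trans (row_condition_iff ha0 ha1 ha hk)⟩
  · intro s hs s' hs' h
    have hs := (mem_filter.1 hs).2
    have hs' := (mem_filter.1 hs').2
    have heq : ∀ k, k ≠ l → s k = s' k := fun k hk => by
      simpa [Function.update_of_ne hk] using congrFun h k
    funext k
    by_cases hk : k = l
    · rw [hk]
      have hiff : (s l).Nonempty ↔ (s' l).Nonempty := by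
        rw [hs.2, hs'.2]
        exact or_congr_right (exists_congr fun i => and_congr_right fun hi => by
          rw [heq i hi.ne])
      have h1 := hs.1 l
      have h2 := hs'.1 l
      rw [hIci, subset_singleton_iff] at h1 h2
      rcases h1 with h1 | h1 <;> rcases h2 with h2 | h2 <;> simp_all
    · exact heq k hk
  · intro s hs
    have hs := (mem_filter.1 hs).2
    refine ⟨Function.update s l (if 0 < a l ∨ ∃ i < l, l ∈ s i then {l} else ∅),
      mem_filter.2 ⟨mem_univ _, fun k => ?_, fun k => ?_⟩, ?_⟩
    · by_cases hk : k = l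
      · subst hk
        rw [Function.update_self, hIci]
        split_ifs <;> simp
      · rw [Function.update_of_ne hk]
        exact (hs k).1
    · by_cases hk : k = l
      · subst hk
        rw [Function.update_self]
        have : (∃ i < l, l ∈ Function.update s l
            (if 0 < a l ∨ ∃ i < l, l ∈ s i then {l} else ∅) i) ↔ ∃ i < l, l ∈ s i :=
          exists_congr fun i => and_congr_right fun hi => by rw [Function.update_of_ne hi.ne]
        rw [this]
        split_ifs with h <;> simp [h]
      · rw [row_condition_iff ha0 ha1 ha hk, Function.update_of_ne hk, Function.update_of_ne h0l]
        exact (hs k).2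
    · have hlast : s l = {l} := by
        have h1 := (hs l).1
        rw [hIci, subset_singleton_iff] at h1
        exact h1.resolve_left ((hs l).2.2 fun h => absurd h h1l).ne_empty
      funext k
      by_cases hk : k = l
      · subst hk
        simp [hlast]
      · simp [Function.update_of_ne hk]
  · intro s hs
    have hs := (mem_filter.1 hs).2
    refine prod_congr rfl fun k _ => ?_
    by_cases hk : k = l
    · subst hk
      have := card_le_card (hs.1 l)
      rw [hIci, card_singleton] at this
      simp [Nat.sub_eq_zero_of_le this]
    · simp [Function.update_of_ne hk]

lemma prod_sum_later_rows {R : Type*} [CommRing R] (t : R) :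
    ∏ k : Fin (p + 1), ∑ B ∈ (Ici k.succ.succ).powerset.filter (·.Nonempty), t ^ (B.card - 1) =
      ∏ k ∈ range (p + 1), ∑ j ∈ range (k + 1), (t + 1) ^ j := by
  rw [← prod_range_reflect, ← Fin.prod_univ_eq_prod_range
    (fun k => ∑ j ∈ range (p + 1 - 1 - k + 1), (t + 1) ^ j)]
  refine prod_congr rfl fun k _ => ?_
  rw [sum_powerset_filter_nonempty_pow_card_sub_one, Fin.card_Ici]
  congr 2
  simp only [Fin.val_succ]
  omega

open Classical in
lemma sum_isValidSupport {R : Type*} [CommRing R] (t : R) (ha0 : 0 < a 0) (ha1 : a 1 = 0)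
    (ha : ∀ i : Fin (p + 3), 2 ≤ (i : ℕ) → i ≠ Fin.last (p + 2) → 0 < a i) :
    ∑ s ∈ univ.filter (IsValidSupport a), ∏ k, t ^ ((s k).card - 1) =
      (1 + (t + 1) ^ (p + 2)) * ∏ k ∈ range (p + 2), ∑ j ∈ range (k + 1), (t + 1) ^ j := by
  let rows : Fin (p + 3) → Finset (Finset (Fin (p + 3))) :=
    fun k => (Ici k).powerset.filter (·.Nonempty)
  let without : Fin (p + 3) → Finset (Finset (Fin (p + 3))) :=
    Fin.cons ((univ.erase 1).powerset.filter (·.Nonempty))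
      (Fin.cons {∅} fun k => rows k.succ.succ)
  let through : Fin (p + 3) → Finset (Finset (Fin (p + 3))) :=
    Fin.cons ((univ : Finset (Fin (p + 3))).powerset.filter (1 ∈ ·)) fun k => rows k.succ
  have h01 : (Fin.succ 0 : Fin (p + 3)) = 1 := rfl
  have hIci : Ici (0 : Fin (p + 3)) = univ := by ext; simp
  have hss : ∀ k : Fin (p + 1), (k.succ.succ : Fin (p + 3)) ≠ 1 := fun k h =>
    Fin.succ_ne_zero k (Fin.succ_injective _ h)
  rw [sum_isValidSupport_eq_sum_nonempty_last t ha0 ha1 ha,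
    ← sum_filter_add_sum_filter_not _ (fun s => 1 ∉ s 0)]
  have hwithout : (univ.filter (fun s : Fin (p + 3) → Finset (Fin (p + 3)) =>
      ∀ k, s k ⊆ Ici k ∧ ((s k).Nonempty ↔ (k = 1 → 1 ∈ s 0)))).filter (fun s => 1 ∉ s 0) =
      Fintype.piFinset without := by
    ext s
    simp only [mem_filter, mem_univ, true_and, Fintype.mem_piFinset]
    constructor
    · rintro ⟨hs, h⟩
      refine Fin.cases ?_ (Fin.cases ?_ fun k => ?_)
      · simpa [without, subset_erase, h] using hs 0
      · simpa [without, h01, h] using (hs 1).2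
      · simpa [without, rows, hss] using hs k.succ.succ
    · intro hs
      have h0 : 1 ∉ s 0 ∧ (s 0).Nonempty := by simpa [without, subset_erase] using hs 0
      have h1 : s 1 = ∅ := mem_singleton.1 (hs 1)
      refine ⟨Fin.cases ?_ (Fin.cases ?_ fun k => ?_), h0.1⟩
      · simpa [hIci] using h0.2
      · simp [h01, h1, h0.1]
      · simpa [without, rows, hss] using hs k.succ.succ
  have hthrough : (univ.filter (fun s : Fin (p + 3) → Finset (Fin (p + 3)) =>
      ∀ k, s k ⊆ Ici k ∧ ((s k).Nonempty ↔ (k = 1 → 1 ∈ s 0)))).filter (fun s => ¬ 1 ∉ s 0) =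
      Fintype.piFinset through := by
    ext s
    simp only [mem_filter, mem_univ, true_and, Fintype.mem_piFinset, not_not]
    constructor
    · rintro ⟨hs, h⟩
      refine Fin.cases ?_ fun k => ?_
      · simpa [through] using h
      · simpa [through, rows, h] using hs k.succ
    · intro hs
      have h : 1 ∈ s 0 := by simpa [through] using hs 0
      refine ⟨Fin.cases ?_ fun k => ?_, h⟩
      · exact ⟨hIci ▸ subset_univ _, by simp [h], fun _ => ⟨1, h⟩⟩
      · simpa [through, rows, h] using hs k.succ
  rw [hwithout, hthrough, ← prod_univ_sum without (fun _ B => t ^ (B.card - 1)),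
    ← prod_univ_sum through (fun _ B => t ^ (B.card - 1)),
    Fin.prod_univ_succ (n := p + 2), Fin.prod_univ_succ (n := p + 1),
    Fin.prod_univ_succ (n := p + 2), Fin.prod_univ_succ (n := p + 1)]
  simp only [without, through, rows, Fin.cons_zero, Fin.cons_succ, prod_sum_later_rows]
  rw [sum_powerset_filter_mem_pow_card_sub_one t (mem_univ _),
    sum_powerset_filter_nonempty_pow_card_sub_one,
    sum_powerset_filter_nonempty_pow_card_sub_one, prod_range_succ _ (p + 1)]
  simp [Fin.card_Ici, card_erase_of_mem]
  ring

end Signature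

end TeslerPolytope

/-- Let `n ≥ 3` and let `a` have (1-based) signature `a₁ > 0`, `a₂ = 0`, `a_i > 0`
for `3 ≤ i ≤ n-1` (`a_n` arbitrary).  Then `Tes_n(a)` has exactly `2·(n-1)!` vertices
and `∑_{i=0}^{C(n,2)} f_i (x-1)^i = (1 + x^{n-1}) · [n-1]!_x` in `ℤ[x]`. -/
theorem teslerPolytope_other_simple_case (n : ℕ) (hn : 3 ≤ n) (a : Fin n → ℕ)
    (ha1 : 0 < a ⟨0, by omega⟩) (ha2 : a ⟨1, by omega⟩ = 0)
    (ha : ∀ i : Fin n, 2 ≤ (i : ℕ) → (i : ℕ) + 1 < n → 0 < a i) :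
    (Set.extremePoints ℝ (TeslerPolytope n a)).ncard = 2 * (n - 1).factorial ∧
    (∑ i ∈ Finset.range (n.choose 2 + 1),
        (faceCount (TeslerPolytope n a) i : Polynomial ℤ) * (X - 1) ^ i) =
      (1 + (X : Polynomial ℤ) ^ (n - 1)) *
        ∏ k ∈ Finset.range (n - 1), ∑ j ∈ Finset.range (k + 1), (X : Polynomial ℤ) ^ j := by
  obtain ⟨p, rfl⟩ := Nat.exists_eq_add_of_le' hn
  have hface : ∑ i ∈ range ((p + 3).choose 2 + 1),
      (faceCount (TeslerPolytope (p + 3) a) i : ℤ[X]) * (X - 1) ^ i =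
      (1 + (X : ℤ[X]) ^ (p + 2)) *
        ∏ k ∈ range (p + 2), ∑ j ∈ range (k + 1), (X : ℤ[X]) ^ j := by
    classical
    rw [TeslerPolytope.sum_faceCount_mul_pow, TeslerPolytope.sum_isValidSupport _ ha1 ha2
      fun i hi hlast => ha i hi (by
        have := Fin.val_lt_last hlast
        omega), sub_add_cancel]
  refine ⟨?_, hface⟩
  have hvertex := congrArg (Polynomial.eval 1) hface
  simp only [eval_finsetSum, eval_mul, eval_natCast, eval_pow, eval_sub, eval_X, eval_one,
    sub_self, eval_add, eval_prod, one_pow, sum_const, card_range, nsmul_eq_mul, mul_one] at hvertex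
  rw [sum_range_succ'] at hvertex
  rw [TeslerPolytope.eq_standardPolyhedron, ncard_extremePoints_standardPolyhedron,
    ← TeslerPolytope.eq_standardPolyhedron, ← prod_range_add_one_eq_factorial]
  zify
  simpa [one_add_one_eq_two] using hvertex
end

section
/- For n ≥ 1, let Q_n ⊆ ℝ^{E}, where E = {(i,j) : 1 ≤ i < j ≤ n}, be the set of tuples (x_{i,j})_{(i,j) ∈ E} with all x_{i,j} ≥ 0 such that for each k = 1,…,n, 1 + Σ_{i<k} x_{i,k} − Σ_{j>k} x_{k,j} ≥ 0. Then the Lebesgue measure of Q_n in ℝ^{C(n,2)} equals 2^{C(n,2)} / ∏_{i=1}^n i!, where C(n,2) = n(n−1)/2. Equivalently, the normalized volume C(n,2)! · Leb(Q_n) of the Tesler polytope Tes_n(1,1,…,1) equals C(n,2)! · 2^{C(n,2)} / ∏_{i=1}^n i!. -/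
open Finset MeasureTheory

/-- The projected Tesler polytope `Q_n ⊆ ℝ^{E}`, `E = {(i,j) : 1 ≤ i < j ≤ n}`:
tuples `x` with `x_{i,j} ≥ 0` for all `(i,j) ∈ E` and
`1 + ∑_{i<k} x_{i,k} - ∑_{j>k} x_{k,j} ≥ 0` for every `k = 1, …, n`.
It is the image of `Tes_n(1,…,1)` under the unimodular projection forgetting the
diagonal entries. -/
def teslerRegion (n : ℕ) : Set ({p : Fin n × Fin n // p.1 < p.2} → ℝ) :=
  {x | (∀ e, 0 ≤ x e) ∧
       ∀ k : Fin n,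
         0 ≤ 1 + (∑ e ∈ univ.filter (fun e : {p : Fin n × Fin n // p.1 < p.2} =>
                    e.val.2 = k), x e)
            - (∑ e ∈ univ.filter (fun e : {p : Fin n × Fin n // p.1 < p.2} =>
                    e.val.1 = k), x e)}

/-- The index set of the strictly upper triangular entries. -/
abbrev UpperPair (n : ℕ) : Type := {p : Fin n × Fin n // p.1 < p.2}

/-- The diagonal entry of the Tesler matrix with off-diagonal entries `x`. -/
def slack {n : ℕ} (x : UpperPair n → ℝ) (k : Fin n) : ℝ :=
  1 + (∑ e ∈ univ.filter (fun e : UpperPair n => e.val.2 = k), x e)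
    - (∑ e ∈ univ.filter (fun e : UpperPair n => e.val.1 = k), x e)

theorem mem_teslerRegion {n : ℕ} {x : UpperPair n → ℝ} :
    x ∈ teslerRegion n ↔ (∀ e, 0 ≤ x e) ∧ ∀ k, 0 ≤ slack x k := Iff.rfl

theorem continuous_slack {n : ℕ} (k : Fin n) :
    Continuous fun x : UpperPair n → ℝ => slack x k := by
  unfold slack
  fun_prop

theorem slack_update {n : ℕ} (x : UpperPair n → ℝ) (e : UpperPair n) (t : ℝ) (k : Fin n) :
    slack (Function.update x e t) k =
      slack x k + (if e.val.2 = k then t - x e else 0) - (if e.val.1 = k then t - x e else 0) := by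
  have h : Function.update x e t = x + Pi.single e (t - x e) := by
    ext i
    by_cases hi : i = e
    · subst hi; simp
    · simp [hi]
  have key : ∀ p : UpperPair n → Prop, [DecidablePred p] →
      ∑ i ∈ univ.filter p, (Pi.single e (t - x e) : UpperPair n → ℝ) i =
        if p e then t - x e else 0 := by
    intro p _
    simp
  simp only [slack, h, Pi.add_apply, Finset.sum_add_distrib]
  rw [key, key]
  ring

/-- Weighted summation of the hook sum equations. -/
theorem sum_mul_slack {R : Type*} [CommRing R] [Algebra ℝ R] {n : ℕ} (x : UpperPair n → ℝ)
    (w : Fin n → R) :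
    ∑ k, algebraMap ℝ R (slack x k) * w k =
      ∑ k, w k - ∑ e : UpperPair n, algebraMap ℝ R (x e) * (w e.val.1 - w e.val.2) := by
  have h (g : UpperPair n → Fin n) :
      ∑ k, (∑ e ∈ univ.filter (fun e => g e = k), algebraMap ℝ R (x e)) * w k =
        ∑ e, algebraMap ℝ R (x e) * w (g e) := by
    rw [← Finset.sum_fiberwise univ g]
    refine Finset.sum_congr rfl fun k _ => ?_
    rw [Finset.sum_mul]
    refine Finset.sum_congr rfl fun e he => ?_
    rw [(Finset.mem_filter.1 he).2]
  simp only [slack, map_add, map_sub, map_one, map_sum, add_mul, sub_mul, one_mul, mul_sub,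
    Finset.sum_add_distrib, Finset.sum_sub_distrib]
  rw [h, h]
  ring

theorem isClosed_teslerRegion (n : ℕ) : IsClosed (teslerRegion n) := by
  have : teslerRegion n =
      (⋂ e, {x | 0 ≤ x e}) ∩ ⋂ k, {x | 0 ≤ slack x k} := by
    ext x; simp [mem_teslerRegion]
  rw [this]
  exact (isClosed_iInter fun e => isClosed_le continuous_const (continuous_apply e)).inter
    (isClosed_iInter fun k => isClosed_le continuous_const (continuous_slack k))

theorem isCompact_teslerRegion (n : ℕ) : IsCompact (teslerRegion n) := by
  refine (isCompact_Icc (a := (0 : UpperPair n → ℝ))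
    (b := fun _ => ∑ k : Fin n, ((n : ℝ) - (k : ℕ)))).of_isClosed_subset
      (isClosed_teslerRegion n) ?_
  intro x hx
  obtain ⟨h0, hs⟩ := mem_teslerRegion.1 hx
  refine ⟨h0, fun e => ?_⟩
  have hc (k : Fin n) : 0 ≤ (n : ℝ) - (k : ℕ) := by
    rw [sub_nonneg]; exact_mod_cast k.2.le
  have h := sum_mul_slack x (fun k : Fin n => (n : ℝ) - (k : ℕ))
  have h1 : 0 ≤ ∑ k, algebraMap ℝ ℝ (slack x k) * ((n : ℝ) - (k : ℕ)) :=
    Finset.sum_nonneg fun k _ => mul_nonneg (hs k) (hc k)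
  have h2 : x e ≤ ∑ e : UpperPair n, x e :=
    Finset.single_le_sum (f := x) (fun e _ => h0 e) (Finset.mem_univ e)
  have h3 : ∑ e : UpperPair n, x e ≤ ∑ e : UpperPair n, algebraMap ℝ ℝ (x e) *
      (((n : ℝ) - (e.val.1 : ℕ)) - ((n : ℝ) - (e.val.2 : ℕ))) := by
    refine Finset.sum_le_sum fun e _ => ?_
    have : ((e.val.1 : ℕ) : ℝ) + 1 ≤ (e.val.2 : ℕ) := by exact_mod_cast e.2
    exact le_mul_of_one_le_right (h0 e) (by linarith)
  linarith

theorem integrableOn_teslerRegion {n : ℕ} {f : (UpperPair n → ℝ) → ℝ} (hf : Continuous f) :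
    IntegrableOn f (teslerRegion n) :=
  hf.continuousOn.integrableOn_compact (isCompact_teslerRegion n)

/-- A function whose integral along every line in one coordinate direction vanishes has integral
zero. -/
theorem integral_eq_zero_of_update {ι : Type*} [Fintype ι] [DecidableEq ι] (e : ι)
    {f : (ι → ℝ) → ℝ} (hf : Measurable f) (hint : Integrable f)
    (hfib : ∀ x, Integrable fun t => f (Function.update x e t))
    (hzero : ∀ x, ∫ t, f (Function.update x e t) = 0) : ∫ x, f x = 0 := by
  have h : ∫⁻ x, ENNReal.ofReal (f x) = ∫⁻ x, ENNReal.ofReal (-f x) := by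
    refine lintegral_eq_of_lmarginal_eq {e} hf.ennreal_ofReal hf.neg.ennreal_ofReal ?_
    ext x
    rw [lmarginal_singleton, lmarginal_singleton]
    have h1 := integral_eq_lintegral_pos_part_sub_lintegral_neg_part (hfib x)
    rw [hzero x, eq_comm, sub_eq_zero] at h1
    refine (ENNReal.toReal_eq_toReal_iff' ?_ ?_).1 h1
    · exact (hfib x).lintegral_lt_top.ne
    · exact (hfib x).neg.lintegral_lt_top.ne
  rw [integral_eq_lintegral_pos_part_sub_lintegral_neg_part hint, h, sub_self]

theorem setIntegral_cubic_eq_zero (A B c : ℝ) :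
    ∫ t in Set.Icc (max 0 (-B)) A, (t * ((B + t) - (A - t)) - (A - t) * (B + t)) * c = 0 := by
  rcases lt_or_ge A (max 0 (-B)) with h | h
  · rw [Set.Icc_eq_empty (not_le.2 h)]; simp
  rw [integral_Icc_eq_integral_Ioc, ← intervalIntegral.integral_of_le h]
  have hd : ∀ t ∈ Set.uIcc (max 0 (-B)) A, HasDerivAt (fun t => -(t * (A - t) * (B + t)) * c)
      ((t * ((B + t) - (A - t)) - (A - t) * (B + t)) * c) t := by
    intro t _
    have h1 : HasDerivAt (fun t : ℝ => A - t) (-1) t := by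
      simpa using (hasDerivAt_id t).const_sub A
    have h2 : HasDerivAt (fun t : ℝ => B + t) 1 t := by
      simpa using (hasDerivAt_id t).const_add B
    refine ((((hasDerivAt_id' t).mul h1).mul h2).neg.mul_const c).congr_deriv ?_
    simp only [Pi.mul_apply]
    ring
  rw [intervalIntegral.integral_eq_sub_of_hasDerivAt hd
    (Continuous.intervalIntegrable (by fun_prop) _ _)]
  rcases max_choice 0 (-B) with h0 | h0 <;> rw [h0] <;> ring

/-- Integration by parts over the Tesler region in the direction of one coordinate. -/
theorem setIntegral_teslerRegion_parts {n : ℕ} (e : UpperPair n) {T : (UpperPair n → ℝ) → ℝ}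
    (hT : Continuous T) (hTe : ∀ x t, T (Function.update x e t) = T x) :
    ∫ x in teslerRegion n, x e * (slack x e.val.2 - slack x e.val.1) * T x =
      ∫ x in teslerRegion n, slack x e.val.1 * slack x e.val.2 * T x := by
  have hne : e.val.1 ≠ e.val.2 := e.2.ne
  have hc1 := continuous_slack e.val.1
  have hc2 := continuous_slack e.val.2
  rw [← sub_eq_zero, ← integral_sub (integrableOn_teslerRegion (by fun_prop))
    (integrableOn_teslerRegion (by fun_prop))]
  set G : (UpperPair n → ℝ) → ℝ := fun x => x e * (slack x e.val.2 - slack x e.val.1) * T x -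
    slack x e.val.1 * slack x e.val.2 * T x with hG
  have hGc : Continuous G := by fun_prop
  have hm : MeasurableSet (teslerRegion n) := (isClosed_teslerRegion n).measurableSet
  rw [← integral_indicator hm]
  have hfib (x : UpperPair n → ℝ) :
      (fun t => (teslerRegion n).indicator G (Function.update x e t)) = 0 ∨
      (fun t => (teslerRegion n).indicator G (Function.update x e t)) =
        (Set.Icc (max 0 (-(slack x e.val.2 - x e))) (slack x e.val.1 + x e)).indicator
          (fun t => (t * (((slack x e.val.2 - x e) + t) - ((slack x e.val.1 + x e) - t)) -
            ((slack x e.val.1 + x e) - t) * ((slack x e.val.2 - x e) + t)) * T x) := by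
    by_cases hD : (∀ e', e' ≠ e → 0 ≤ x e') ∧
        ∀ k, k ≠ e.val.1 → k ≠ e.val.2 → 0 ≤ slack x k
    · right
      ext t
      have hmem : Function.update x e t ∈ teslerRegion n ↔
          t ∈ Set.Icc (max 0 (-(slack x e.val.2 - x e))) (slack x e.val.1 + x e) := by
        rw [mem_teslerRegion, Set.mem_Icc, max_le_iff]
        constructor
        · rintro ⟨h0, hs⟩
          have h1 := h0 e
          have h2 := hs e.val.1
          have h3 := hs e.val.2
          simp only [slack_update, hne, hne.symm, if_true, if_false,
            Function.update_self] at h1 h2 h3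
          refine ⟨⟨h1, ?_⟩, ?_⟩ <;> linarith
        · rintro ⟨⟨h1, h2⟩, h3⟩
          constructor
          · intro e'
            by_cases he : e' = e
            · subst he; simpa using h1
            · simpa [he] using hD.1 e' he
          · intro k
            rw [slack_update]
            by_cases hk1 : k = e.val.1
            · subst hk1; simp only [hne.symm, if_true, if_false]; linarith
            by_cases hk2 : k = e.val.2
            · subst hk2; simp only [hne, if_true, if_false]; linarith
            · simpa [Ne.symm hk1, Ne.symm hk2] using hD.2 k hk1 hk2
      by_cases ht : Function.update x e t ∈ teslerRegion n
      · rw [Set.indicator_of_mem ht, Set.indicator_of_mem (hmem.1 ht)]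
        simp only [hG, hTe, slack_update, hne, hne.symm, if_true, if_false,
          Function.update_self]
        ring
      · rw [Set.indicator_of_notMem ht, Set.indicator_of_notMem (mt hmem.2 ht)]
    · left
      ext t
      refine Set.indicator_of_notMem (fun ht => hD ?_) _
      obtain ⟨h0, hs⟩ := mem_teslerRegion.1 ht
      constructor
      · intro e' he
        simpa [he] using h0 e'
      · intro k hk1 hk2
        simpa [slack_update, Ne.symm hk1, Ne.symm hk2] using hs k
  refine integral_eq_zero_of_update e (hGc.measurable.indicator hm)
    ((integrable_indicator_iff hm).2 (integrableOn_teslerRegion hGc)) (fun x => ?_) fun x => ?_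
  · rcases hfib x with h | h <;> rw [h]
    · exact integrable_zero _ _ _
    · exact (integrable_indicator_iff measurableSet_Icc).2
        (Continuous.integrableOn_Icc (by fun_prop))
  · rcases hfib x with h | h <;> rw [h]
    · simp
    · rw [integral_indicator measurableSet_Icc]
      exact setIntegral_cubic_eq_zero _ _ _

open Polynomial in
/-- The generating polynomial of the elementary symmetric functions of `y i`, `i ∈ s`. -/
noncomputable def esymmGen {ι : Type*} (s : Finset ι) (y : ι → ℝ) : ℝ[X] :=
  ∏ i ∈ s, (1 + C (y i) * X)

open Polynomial in
theorem continuous_coeff_esymmGen {ι α : Type*} [TopologicalSpace α] (s : Finset ι)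
    {y : α → ι → ℝ} (hy : ∀ i, Continuous fun a => y a i) (k : ℕ) :
    Continuous fun a => (esymmGen s (y a)).coeff k := by
  classical
  induction s using Finset.induction_on generalizing k with
  | empty => simpa [esymmGen] using continuous_const
  | insert i s hi ih =>
    have h (a : α) : esymmGen (insert i s) (y a) =
        esymmGen s (y a) + C (y a i) * (X * esymmGen s (y a)) := by
      simp only [esymmGen, Finset.prod_insert hi]
      ring
    simp only [h, coeff_add, coeff_C_mul]
    refine (ih k).add ((hy i).mul ?_)
    cases k with
    | zero => simpa using continuous_const
    | succ k => simpa only [coeff_X_mul] using ih k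

open Polynomial in
theorem derivative_esymmGen {ι : Type*} [DecidableEq ι] (s : Finset ι) (y : ι → ℝ) :
    derivative (esymmGen s y) = ∑ i ∈ s, C (y i) * esymmGen (s.erase i) y := by
  rw [esymmGen, derivative_prod_finset]
  refine Finset.sum_congr rfl fun i _ => ?_
  simp only [derivative_add, derivative_one, zero_add, derivative_C_mul, derivative_X, mul_one]
  exact mul_comm _ _

open Polynomial in
theorem esymmGen_eq_mul_erase {ι : Type*} [DecidableEq ι] {s : Finset ι} {i : ι} (hi : i ∈ s)
    (y : ι → ℝ) : esymmGen s y = (1 + C (y i) * X) * esymmGen (s.erase i) y :=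
  (Finset.mul_prod_erase s _ hi).symm

open Polynomial in
theorem sum_esymmGen_erase {ι : Type*} [DecidableEq ι] (s : Finset ι) (y : ι → ℝ) :
    ∑ i ∈ s, esymmGen (s.erase i) y =
      (#s : ℝ[X]) * esymmGen s y - X * derivative (esymmGen s y) := by
  rw [derivative_esymmGen, Finset.mul_sum, ← nsmul_eq_mul, ← Finset.sum_const,
    ← Finset.sum_sub_distrib]
  refine Finset.sum_congr rfl fun i hi => ?_
  rw [esymmGen_eq_mul_erase hi]
  ring

theorem sum_erase_eq_two_nsmul_sum_upperPair {M : Type*} [AddCommMonoid M] {n : ℕ}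
    (f : Fin n → Fin n → M) (hf : ∀ i j, f i j = f j i) :
    ∑ i, ∑ j ∈ univ.erase i, f i j = 2 • ∑ e : UpperPair n, f e.val.1 e.val.2 := by
  have h1 : ∑ e : UpperPair n, f e.val.1 e.val.2 = ∑ i, ∑ j, if i < j then f i j else 0 := by
    rw [← Fintype.sum_prod_type', ← Finset.sum_filter]
    exact (Finset.sum_subtype _ (by simp) (fun p : Fin n × Fin n => f p.1 p.2)).symm
  have h2 : ∑ i, ∑ j, (if i < j then f i j else 0) = ∑ i, ∑ j, if j < i then f i j else 0 := by
    rw [Finset.sum_comm]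
    simp only [hf]
  rw [two_nsmul, h1]
  nth_rewrite 2 [h2]
  rw [← Finset.sum_add_distrib]
  refine Finset.sum_congr rfl fun i _ => ?_
  rw [← Finset.sum_add_distrib, ← Finset.sum_subset (Finset.erase_subset i univ)]
  · refine Finset.sum_congr rfl fun j hj => ?_
    rcases lt_or_gt_of_ne (Finset.ne_of_mem_erase hj) with h | h <;> simp [h, h.not_gt]
  · intro j _ hj
    have : j = i := by simpa using hj
    simp [this]

open Polynomial in
theorem derivative_derivative_esymmGen {n : ℕ} (y : Fin n → ℝ) :
    derivative (derivative (esymmGen univ y)) = 2 * ∑ e : UpperPair n,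
      C (y e.val.1 * y e.val.2) * esymmGen ((univ.erase e.val.1).erase e.val.2) y := by
  have h := sum_erase_eq_two_nsmul_sum_upperPair
    (fun i j : Fin n => C (y i * y j) * esymmGen ((univ.erase i).erase j) y) (fun i j => by
      rw [mul_comm (y i), Finset.erase_right_comm])
  rw [nsmul_eq_mul, Nat.cast_ofNat] at h
  rw [← h, derivative_esymmGen, derivative_sum]
  refine Finset.sum_congr rfl fun i _ => ?_
  rw [derivative_C_mul, derivative_esymmGen, Finset.mul_sum]
  simp only [C_mul, mul_assoc]

open Polynomial in
/-- The hook sum equations, weighted by the products of the remaining diagonal entries. -/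
theorem esymmGen_slack_identity {n : ℕ} (x : UpperPair n → ℝ) :
    (n : ℝ[X]) * esymmGen univ (slack x) - X * derivative (esymmGen univ (slack x)) =
      derivative (esymmGen univ (slack x)) + ∑ e : UpperPair n,
        C (x e * (slack x e.val.2 - slack x e.val.1)) *
          (X * esymmGen ((univ.erase e.val.1).erase e.val.2) (slack x)) := by
  have h := sum_mul_slack x (fun i => esymmGen (univ.erase i) (slack x))
  rw [sum_esymmGen_erase, Finset.card_fin] at h
  simp only [algebraMap_eq] at h
  rw [← derivative_esymmGen] at h
  rw [eq_sub_iff_add_eq] at h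
  rw [← h, add_right_inj]
  refine Finset.sum_congr rfl fun e _ => ?_
  rw [esymmGen_eq_mul_erase (s := univ.erase e.val.1) (i := e.val.2) (by simp [e.2.ne']),
    esymmGen_eq_mul_erase (s := univ.erase e.val.2) (i := e.val.1) (by simp [e.2.ne]),
    Finset.erase_right_comm (a := e.val.2)]
  simp only [C_mul, C_sub]
  ring

theorem esymmGen_slack_update {n : ℕ} (e : UpperPair n) (x : UpperPair n → ℝ) (t : ℝ) :
    esymmGen ((univ.erase e.val.1).erase e.val.2) (slack (Function.update x e t)) =
      esymmGen ((univ.erase e.val.1).erase e.val.2) (slack x) := by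
  refine Finset.prod_congr rfl fun i hi => ?_
  simp only [Finset.mem_erase, Finset.mem_univ, and_true] at hi
  rw [slack_update, if_neg (Ne.symm hi.1), if_neg (Ne.symm hi.2)]
  simp

open Polynomial in
theorem integral_coeff_esymmGen_succ (n k : ℕ) :
    ((n : ℝ) - k) * ∫ x in teslerRegion n, (esymmGen univ (slack x)).coeff k =
      (k + 1) * (1 + k / 2) *
        ∫ x in teslerRegion n, (esymmGen univ (slack x)).coeff (k + 1) := by
  set T : UpperPair n → (UpperPair n → ℝ) → ℝ := fun e x =>
    (X * esymmGen ((univ.erase e.val.1).erase e.val.2) (slack x)).coeff k with hT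
  have hTc (e : UpperPair n) : Continuous (T e) := by
    cases k with
    | zero => simpa [hT] using continuous_const
    | succ k => simpa only [hT, coeff_X_mul] using
        continuous_coeff_esymmGen _ continuous_slack k
  have hc (k : ℕ) : Continuous fun x : UpperPair n → ℝ => (esymmGen univ (slack x)).coeff k :=
    continuous_coeff_esymmGen _ continuous_slack k
  have hX (p : ℝ[X]) : (X * derivative p).coeff k = k * p.coeff k := by
    cases k with
    | zero => simp
    | succ k => rw [coeff_X_mul, coeff_derivative]; push_cast; ring
  have h1 (x : UpperPair n → ℝ) : ((n : ℝ) - k) * (esymmGen univ (slack x)).coeff k =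
      (k + 1) * (esymmGen univ (slack x)).coeff (k + 1) +
        ∑ e : UpperPair n, x e * (slack x e.val.2 - slack x e.val.1) * T e x := by
    have h := congrArg (fun p : ℝ[X] => p.coeff k) (esymmGen_slack_identity x)
    simp only [coeff_sub, coeff_add, finsetSum_coeff, coeff_C_mul, hX, coeff_derivative,
      coeff_natCast_mul] at h
    simp only [hT]
    linarith
  have h2 (x : UpperPair n → ℝ) : (k * (k + 1) / 2) * (esymmGen univ (slack x)).coeff (k + 1) =
      ∑ e : UpperPair n, slack x e.val.1 * slack x e.val.2 * T e x := by
    have h' : X * derivative (derivative (esymmGen univ (slack x))) = C 2 * ∑ e : UpperPair n,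
        C (slack x e.val.1 * slack x e.val.2) *
          (X * esymmGen ((univ.erase e.val.1).erase e.val.2) (slack x)) := by
      rw [derivative_derivative_esymmGen, mul_left_comm, Finset.mul_sum, map_ofNat]
      exact congrArg _ (Finset.sum_congr rfl fun e _ => mul_left_comm _ _ _)
    have h := congrArg (fun p : ℝ[X] => p.coeff k) h'
    simp only [hX, coeff_derivative, coeff_C_mul, finsetSum_coeff] at h
    simp only [hT]
    linarith
  rw [← integral_const_mul]
  simp only [h1]
  rw [integral_add, integral_finsetSum, integral_const_mul]
  · simp only [fun e : UpperPair n => setIntegral_teslerRegion_parts e (hTc e)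
      (fun x t => by simp only [hT, esymmGen_slack_update])]
    rw [← integral_finsetSum]
    · simp only [← h2]
      rw [integral_const_mul]
      ring
    · intro e _
      exact integrableOn_teslerRegion
        (((continuous_slack _).mul (continuous_slack _)).mul (hTc e))
  · intro e _
    exact integrableOn_teslerRegion (((continuous_apply e).mul
      ((continuous_slack _).sub (continuous_slack _))).mul (hTc e))
  · exact integrableOn_teslerRegion (continuous_const.mul (hc _))
  · exact integrableOn_teslerRegion (continuous_finsetSum _ fun e _ =>
      ((continuous_apply e).mul ((continuous_slack _).sub (continuous_slack _))).mul (hTc e))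

theorem integral_coeff_esymmGen (n k : ℕ) (hk : k ≤ n) :
    ((k + 1).factorial : ℝ) * ∫ x in teslerRegion n, (esymmGen univ (slack x)).coeff k =
      n.choose k * 2 ^ k * volume.real (teslerRegion n) := by
  induction k with
  | zero =>
    have h (x : UpperPair n → ℝ) : (esymmGen univ (slack x)).coeff 0 = 1 := by
      simp [esymmGen, Polynomial.coeff_zero_prod]
    simp [h]
  | succ k ih =>
    have h1 := integral_coeff_esymmGen_succ n k
    have h2 := ih (by omega)
    have h3 : (n.choose (k + 1) : ℝ) * (k + 1) = n.choose k * (n - k) := by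
      have := Nat.choose_succ_right_eq n k
      rw [← Nat.cast_sub (by omega : k ≤ n)]
      exact_mod_cast this
    have h4 : (((k + 1 + 1).factorial : ℕ) : ℝ) = (k + 2) * (k + 1).factorial := by
      rw [Nat.factorial_succ (k + 1)]; push_cast; ring
    have hk : (k + 1 : ℝ) ≠ 0 := by positivity
    rw [h4, pow_succ]
    apply mul_left_cancel₀ hk
    linear_combination (-2 * ((k + 1).factorial : ℝ)) * h1 + 2 * ((n : ℝ) - k) * h2 -
      2 ^ k * 2 * volume.real (teslerRegion n) * h3

theorem integral_prod_slack (n : ℕ) :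
    ((n + 1).factorial : ℝ) * ∫ x in teslerRegion n, ∏ k, slack x k =
      2 ^ n * volume.real (teslerRegion n) := by
  have h (x : UpperPair n → ℝ) : (esymmGen univ (slack x)).coeff n = ∏ k, slack x k := by
    have h := Polynomial.coeff_prod_of_natDegree_le (univ : Finset (Fin n))
      (fun i => (1 + Polynomial.C (slack x i) * Polynomial.X)) 1 (fun i _ => by compute_degree)
    rw [Finset.card_fin, mul_one] at h
    rw [esymmGen, h]
    simp [Polynomial.coeff_one]
  simpa [h] using integral_coeff_esymmGen n n le_rfl

/-- A pair in `Fin (n + 1)` either lies in `Fin n` or ends at the last vertex. -/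
def upperPairSuccEquiv (n : ℕ) : UpperPair n ⊕ Fin n ≃ UpperPair (n + 1) where
  toFun := Sum.elim
    (fun e => ⟨(e.val.1.castSucc, e.val.2.castSucc), Fin.castSucc_lt_castSucc_iff.2 e.2⟩)
    (fun i => ⟨(i.castSucc, Fin.last n), Fin.castSucc_lt_last i⟩)
  invFun e := if h : e.val.2 = Fin.last n
    then Sum.inr (e.val.1.castPred (Fin.ne_last_of_lt e.2))
    else Sum.inl ⟨(e.val.1.castPred (Fin.ne_last_of_lt e.2), e.val.2.castPred h),
      Fin.castPred_lt_castPred e.2 h⟩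
  left_inv := by
    rintro (e | i)
    · simp [Fin.castSucc_ne_last]
    · simp
  right_inv := by
    intro e
    by_cases h : e.val.2 = Fin.last n
    · apply Subtype.ext
      simp only [h, dite_true, Sum.elim_inr, Fin.castSucc_castPred]
      exact Prod.ext rfl h.symm
    · apply Subtype.ext
      simp [h]

theorem slack_castSucc {n : ℕ} (x : UpperPair (n + 1) → ℝ) (k : Fin n) :
    slack x k.castSucc = slack (fun e => x (upperPairSuccEquiv n (Sum.inl e))) k -
      x (upperPairSuccEquiv n (Sum.inr k)) := by
  simp only [slack, Finset.sum_filter]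
  rw [← (upperPairSuccEquiv n).sum_comp, ← (upperPairSuccEquiv n).sum_comp]
  simp only [Fintype.sum_sum_type, upperPairSuccEquiv, Equiv.coe_fn_mk, Sum.elim_inl,
    Sum.elim_inr, Fin.castSucc_inj, (Fin.castSucc_ne_last _).symm, if_false,
    Finset.sum_const_zero, Finset.sum_ite_eq', Finset.mem_univ, if_true]
  ring

theorem slack_last_nonneg {n : ℕ} {x : UpperPair (n + 1) → ℝ} (hx : ∀ e, 0 ≤ x e) :
    0 ≤ slack x (Fin.last n) := by
  have h : univ.filter (fun e : UpperPair (n + 1) => e.val.1 = Fin.last n) = ∅ :=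
    Finset.filter_eq_empty_iff.2 fun e _ => Fin.ne_last_of_lt e.2
  rw [slack, h, Finset.sum_empty, sub_zero]
  exact add_nonneg zero_le_one (Finset.sum_nonneg fun e _ => hx e)

theorem mem_teslerRegion_succ {n : ℕ} {x : UpperPair (n + 1) → ℝ} :
    x ∈ teslerRegion (n + 1) ↔
      (fun e => x (upperPairSuccEquiv n (Sum.inl e))) ∈ teslerRegion n ∧
      (fun i => x (upperPairSuccEquiv n (Sum.inr i))) ∈
        Set.Icc 0 (slack fun e => x (upperPairSuccEquiv n (Sum.inl e))) := by
  rw [mem_teslerRegion, mem_teslerRegion, Set.mem_Icc]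
  constructor
  · rintro ⟨h0, hs⟩
    have h1 (k : Fin n) : x (upperPairSuccEquiv n (Sum.inr k)) ≤
        slack (fun e => x (upperPairSuccEquiv n (Sum.inl e))) k := by
      have := hs k.castSucc
      rw [slack_castSucc] at this
      linarith
    exact ⟨⟨fun e => h0 _, fun k => (h0 _).trans (h1 k)⟩, fun k => h0 _, h1⟩
  · rintro ⟨⟨h0, -⟩, h1, h2⟩
    have h3 : ∀ e, 0 ≤ x e := by
      intro e
      obtain ⟨e | i, rfl⟩ := (upperPairSuccEquiv n).surjective e
      · exact h0 e
      · exact h1 i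
    refine ⟨h3, fun k => ?_⟩
    induction k using Fin.lastCases with
    | last => exact slack_last_nonneg h3
    | cast k =>
      rw [slack_castSucc]
      exact sub_nonneg.2 (h2 k)

theorem volume_teslerRegion_succ (n : ℕ) :
    volume (teslerRegion (n + 1)) =
      ENNReal.ofReal (∫ x in teslerRegion n, ∏ k, slack x k) := by
  have hmp := (volume_measurePreserving_sumPiEquivProdPi_symm
    (fun _ : UpperPair n ⊕ Fin n => ℝ))
  have hmp2 := volume_measurePreserving_piCongrLeft
    (fun _ : UpperPair (n + 1) => ℝ) (upperPairSuccEquiv n)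
  have h := hmp2.comp hmp
  have hm : MeasurableSet (teslerRegion n) := (isClosed_teslerRegion n).measurableSet
  have hm' : MeasurableSet (teslerRegion (n + 1)) :=
    (isClosed_teslerRegion (n + 1)).measurableSet
  rw [← h.measure_preimage hm'.nullMeasurableSet, Measure.volume_eq_prod, Measure.prod_apply
    (h.measurable hm')]
  have hc : Continuous fun x : UpperPair n → ℝ => ∏ k, slack x k :=
    continuous_finsetProd _ fun k _ => continuous_slack k
  rw [ofReal_integral_eq_lintegral_ofReal (integrableOn_teslerRegion hc)
    ((ae_restrict_iff' hm).2 (.of_forall fun x hx =>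
      Finset.prod_nonneg fun k _ => (mem_teslerRegion.1 hx).2 k)), ← lintegral_indicator hm]
  refine lintegral_congr fun x => ?_
  have hmem (z : Fin n → ℝ) : z ∈ Prod.mk x ⁻¹'
      ((MeasurableEquiv.piCongrLeft (fun _ => ℝ) (upperPairSuccEquiv n)) ∘
        (MeasurableEquiv.sumPiEquivProdPi fun _ => ℝ).symm ⁻¹' teslerRegion (n + 1)) ↔
      x ∈ teslerRegion n ∧ z ∈ Set.Icc 0 (slack x) := by
    rw [Set.mem_preimage, Set.mem_preimage, mem_teslerRegion_succ]
    have hl (e : UpperPair n ⊕ Fin n) : ((MeasurableEquiv.piCongrLeft (fun _ => ℝ)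
        (upperPairSuccEquiv n)) ∘ (MeasurableEquiv.sumPiEquivProdPi fun _ => ℝ).symm) (x, z)
          (upperPairSuccEquiv n e) = Sum.elim x z e := by
      rw [Function.comp_apply, MeasurableEquiv.coe_piCongrLeft, Equiv.piCongrLeft_apply_apply]
      cases e <;> rfl
    simp only [hl, Sum.elim_inl, Sum.elim_inr]
  by_cases hx : x ∈ teslerRegion n
  · rw [Set.indicator_of_mem hx, show Prod.mk x ⁻¹' _ = Set.Icc 0 (slack x) from
      Set.ext fun z => (hmem z).trans (and_iff_right hx), Real.volume_Icc_pi,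
      ENNReal.ofReal_prod_of_nonneg fun k _ => (mem_teslerRegion.1 hx).2 k]
    simp
  · rw [Set.indicator_of_notMem hx, show Prod.mk x ⁻¹' _ = ∅ from
      Set.eq_empty_of_forall_notMem fun z hz => hx ((hmem z).1 hz).1, measure_empty]

theorem volume_teslerRegion_eq_ofReal (n : ℕ) : volume (teslerRegion n) =
    ENNReal.ofReal (2 ^ n.choose 2 / ∏ i ∈ Finset.range n, ((i + 1).factorial : ℝ)) := by
  induction n with
  | zero =>
    have h : teslerRegion 0 = Set.univ :=
      Set.eq_univ_of_forall fun x => mem_teslerRegion.2 ⟨fun e => e.val.1.elim0, fun k => k.elim0⟩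
    rw [h, volume_pi, Measure.pi_univ]
    simp
  | succ n ih =>
    rw [volume_teslerRegion_succ]
    congr 1
    have h := integral_prod_slack n
    have hf : ((n + 1).factorial : ℝ) ≠ 0 := by positivity
    rw [measureReal_def, ih, ENNReal.toReal_ofReal (by positivity)] at h
    rw [Finset.prod_range_succ, Nat.choose_succ_succ' n 1, Nat.choose_one_right, pow_add,
      mul_comm (2 ^ n : ℝ), ← div_mul_div_comm, mul_div_assoc', eq_div_iff hf]
    linarith

/-- The Lebesgue measure of `Q_n` in `ℝ^{C(n,2)}` is `2^{C(n,2)} / ∏_{i=1}^n i!`;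
equivalently, the normalized volume `C(n,2)! · Leb(Q_n)` of the Tesler polytope
`Tes_n(1,…,1)` equals `C(n,2)! · 2^{C(n,2)} / ∏_{i=1}^n i!`. -/
theorem volume_teslerRegion (n : ℕ) (hn : 1 ≤ n) :
    volume (teslerRegion n) =
      2 ^ n.choose 2 / ∏ i ∈ Finset.range n, ((i + 1).factorial : ENNReal) ∧
    ((n.choose 2).factorial : ENNReal) * volume (teslerRegion n) =
      ((n.choose 2).factorial : ENNReal) *
        (2 ^ n.choose 2 / ∏ i ∈ Finset.range n, ((i + 1).factorial : ENNReal)) := by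
  have h : volume (teslerRegion n) =
      2 ^ n.choose 2 / ∏ i ∈ Finset.range n, ((i + 1).factorial : ENNReal) := by
    rw [volume_teslerRegion_eq_ofReal, ENNReal.ofReal_div_of_pos (by positivity),
      ENNReal.ofReal_pow zero_le_two, ENNReal.ofReal_prod_of_nonneg fun i _ => by positivity]
    simp
  exact ⟨h, by rw [h]⟩
end
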